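/- arXiv:1310.6146 — 4 statements merged into one kernel-verified Lean document; each statement's English description precedes it below -/
import Mathlib

section
/- Rooted-tree representation of the SRK one-step value with Taylor remainder: Let Y(t)=Y(t_0+h) be the one-step value of an autonomous s-stage SRK method whose stage values and one-step value are (n+1)-times continuously differentiable functions of θ near the segment joining 0 and θ(h) and satisfy the stage equations identically in θ, and let a, b^1,…,b^m be (n+1)-times continuously differentiable. Then for every n∈ℕ and every component J there exists ξ∈(0,1) such that Y(t)^J = Y(t_0)^J + Σ over t∈LTS with l(t)≤n of [γ(t)·Σ_{i_1=1}^s z_{i_1}·Φ_{i_1}(t)·F(t)(Y(t_0))^J]/l(t)! + R_n(t,t_0), where z_{i_1}=z_{i_1}^{(0,0)} if the root of t has colour τ and z_{i_1}=Σ_{j_r=1}^m Σ_{ν_r∈M} z_{i_1}^{(j_r,ν_r)} if the root has colour σ_{j_r} (indices shared with Φ_{i_1}(t)), and R_n(t,t_0) = (1/(n+1)!)·Σ_{ν_1,…,ν_{n+1}∈M̄} Δθ_{ν_1}⋯Δθ_{ν_{n+1}}·∂^{n+1}Y^J/(∂θ_{ν_1}⋯∂θ_{ν_{n+1}}) evaluated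 at ξ·θ(h), with Δθ_ν=θ_ν(h). -/
open scoped BigOperators
open Finset MeasureTheory ProbabilityTheory

noncomputable section

namespace SRKPaper

/-- `ℝ^d` with the Euclidean norm. -/
abbrev Evec (d : ℕ) : Type := EuclideanSpace ℝ (Fin d)

/-- The index pairs `(k,ν)` of the SRK method: `det` is `(0,0)`,
`sto k ν` is `(k,ν)` with `k ∈ {1,…,m}`, `ν ∈ M`. -/
inductive SIdx (m : ℕ) (M : Type) : Type where
  | det : SIdx m M
  | sto : Fin m → M → SIdx m M

/-- `M̄ = M ∪ {0}`, with `none` playing the role of the index `0`. -/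
abbrev Mbar (M : Type) : Type := Option M

/-- The real coefficients of an autonomous `s`-stage stochastic Runge–Kutta method. -/
structure SRK (m s : ℕ) (M : Type) : Type where
  α : Fin s → ℝ
  γc : M → SIdx m M → Fin s → ℝ
  A : SIdx m M → Fin s → Fin s → ℝ
  B : M → SIdx m M → Fin m → M → Fin s → Fin s → ℝ

variable {d m s : ℕ} {M : Type}

section SRKdefs
variable [Fintype M]

/-- θ-dependent weights `z^{(k,ν)}`. -/
def SRK.z (c : SRK m s M) (θ : Mbar M → ℝ) : SIdx m M → Fin s → ℝ
  | .det => fun i => c.α i * θ none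
  | .sto k ν => fun i => ∑ ι : M, c.γc ι (.sto k ν) i * θ (some ι)

/-- θ-dependent stage coefficients `Z^{(k,ν),(r,μ)}`; the first index is the
father pair `p = (k,ν)`, the second the son pair. -/
def SRK.Z (c : SRK m s M) (θ : Mbar M → ℝ) (p : SIdx m M) : SIdx m M → Fin s → Fin s → ℝ
  | .det => fun i j => c.A p i j * θ none
  | .sto r μ => fun i j => ∑ ι : M, c.B ι p r μ i j * θ (some ι)

/-- The stage equations of the autonomous SRK method with starting value `y0`. -/
def StageEq (c : SRK m s M) (a : Evec d → Evec d) (b : Fin m → Evec d → Evec d)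
    (y0 : Evec d) (θ : Mbar M → ℝ) (H : SIdx m M → Fin s → Evec d) : Prop :=
  ∀ (p : SIdx m M) (i : Fin s),
    H p i = y0 + (∑ j, c.Z θ p .det i j • a (H .det j))
      + ∑ j, ∑ r, ∑ μ, c.Z θ p (.sto r μ) i j • b r (H (.sto r μ) j)

/-- The one-step value `Y(t)` of the SRK method. -/
def oneStep (c : SRK m s M) (a : Evec d → Evec d) (b : Fin m → Evec d → Evec d)
    (y0 : Evec d) (θ : Mbar M → ℝ) (H : SIdx m M → Fin s → Evec d) : Evec d :=
  y0 + (∑ i, c.z θ .det i • a (H .det i))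
    + ∑ i, ∑ k, ∑ ν, c.z θ (.sto k ν) i • b k (H (.sto k ν) i)

end SRKdefs

/-- A monotonically labelled S-tree with `l+1` nodes: node `0` is the root, the
nonroot nodes are labelled `1,…,l` and are represented by `Fin l` (node `i : Fin l`
has true label `i+1`).  `father i` is the father of node `i+1` (a node label in
`Fin (l+1)`), and `color i` is the colour of node `i+1`: `none` is a deterministic
node `τ`, `some j` a stochastic node `σ_j` with (concrete) variable index `j`. -/
structure STree (l m : ℕ) : Type where
  father : Fin l → Fin (l + 1)
  color : Fin l → Option (Fin m)
  mono : ∀ i : Fin l, (father i).val ≤ i.val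

def STree.equivSubtype (l m : ℕ) :
    STree l m ≃ {p : (Fin l → Fin (l+1)) × (Fin l → Option (Fin m)) //
      ∀ i : Fin l, (p.1 i).val ≤ i.val} where
  toFun t := ⟨(t.father, t.color), t.mono⟩
  invFun p := ⟨p.1.1, p.1.2, p.2⟩
  left_inv t := rfl
  right_inv p := rfl

instance (l m : ℕ) : Fintype (STree l m) := Fintype.ofEquiv _ (STree.equivSubtype l m).symm

/-- The set of sons of the node with label `v`. -/
def STree.child {l m : ℕ} (t : STree l m) (v : Fin (l+1)) : Finset (Fin l) :=
  Finset.univ.filter fun i => t.father i = v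

/-- interpretation of a colour by the corresponding coefficient function (`b^0 = a`). -/
def nodeFun (a : Evec d → Evec d) (b : Fin m → Evec d → Evec d) :
    Option (Fin m) → Evec d → Evec d
  | none => a
  | some j => b j

/-- The elementary differential attached to the subtree rooted at the nonroot node `i`
(fuel-based recursion; the fuel `l` always suffices). -/
def elemFAux (a : Evec d → Evec d) (b : Fin m → Evec d → Evec d) {l : ℕ} (t : STree l m) :
    ℕ → Fin l → Evec d → Evec d
  | 0, _, _ => 0
  | fuel + 1, i, x =>
      iteratedFDeriv ℝ (t.child i.succ).card (nodeFun a b (t.color i)) x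
        fun p => elemFAux a b t fuel ((t.child i.succ).orderIsoOfFin rfl p).1 x

def elemF (a : Evec d → Evec d) (b : Fin m → Evec d → Evec d) {l : ℕ} (t : STree l m)
    (i : Fin l) : Evec d → Evec d := elemFAux a b t l i

/-- The elementary differential `F(t)(x)` of a tree whose root has colour `γ`
(representing the functional `f`). -/
def elemFRoot (f : Evec d → ℝ) (a : Evec d → Evec d) (b : Fin m → Evec d → Evec d)
    {l : ℕ} (t : STree l m) (x : Evec d) : ℝ :=
  iteratedFDeriv ℝ (t.child 0).card f x
    fun p => elemF a b t ((t.child 0).orderIsoOfFin rfl p).1 x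

/-- The elementary differential `F(t)(x)` of a tree whose root has colour `rc`
(`none = τ`, `some j = σ_j`). -/
def elemFRootV (a : Evec d → Evec d) (b : Fin m → Evec d → Evec d) (rc : Option (Fin m))
    {l : ℕ} (t : STree l m) (x : Evec d) : Evec d :=
  iteratedFDeriv ℝ (t.child 0).card (nodeFun a b rc) x
    fun p => elemF a b t ((t.child 0).orderIsoOfFin rfl p).1 x

/-- number of nodes of the subtree rooted at the nonroot node `i` (fuel-based). -/
def sizeAux {l m : ℕ} (t : STree l m) : ℕ → Fin l → ℕ
  | 0, _ => 0
  | fuel + 1, i => 1 + ∑ c ∈ t.child i.succ, sizeAux t fuel c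

def STree.size {l m : ℕ} (t : STree l m) (i : Fin l) : ℕ := sizeAux t l i

/-- density of the subtree rooted at the nonroot node `i`. -/
def densAux {l m : ℕ} (t : STree l m) : ℕ → Fin l → ℕ
  | 0, _ => 1
  | fuel + 1, i => t.size i * ∏ c ∈ t.child i.succ, densAux t fuel c

def STree.densNode {l m : ℕ} (t : STree l m) (i : Fin l) : ℕ := densAux t l i

/-- density `γ(t)` of a tree whose root has colour `γ`. -/
def STree.densDelta {l m : ℕ} (t : STree l m) : ℕ := ∏ c ∈ t.child 0, t.densNode c

/-- density `γ(t)` of a tree (with `l+1` nodes) whose root has colour `τ` or `σ_j`. -/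
def STree.densR {l m : ℕ} (t : STree l m) : ℕ := (l+1) * ∏ c ∈ t.child 0, t.densNode c

/-- number `s(t)` of stochastic nonroot nodes. -/
def STree.scount {l m : ℕ} (t : STree l m) : ℕ :=
  (Finset.univ.filter fun i : Fin l => (t.color i).isSome = true).card

/-- number `d(t)` of deterministic nonroot nodes. -/
def STree.dcount {l m : ℕ} (t : STree l m) : ℕ :=
  (Finset.univ.filter fun i : Fin l => t.color i = none).card

section PhiDefs
variable [Fintype M]

/-- The vector `Ψ^{(p)}` of the subtree rooted at the nonroot node `i`, where `p` is
the index pair of the father of `i` (fuel-based recursion). -/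
def PsiAux (c : SRK m s M) (θ : Mbar M → ℝ) {l : ℕ} (t : STree l m) :
    ℕ → Fin l → SIdx m M → Fin s → ℝ
  | 0, _, _, _ => 1
  | fuel + 1, i, p, q =>
    match t.color i with
    | none => ∑ j, c.Z θ p .det q j * ∏ cc ∈ t.child i.succ, PsiAux c θ t fuel cc .det j
    | some jj => ∑ μ : M, ∑ j, c.Z θ p (.sto jj μ) q j *
        ∏ cc ∈ t.child i.succ, PsiAux c θ t fuel cc (.sto jj μ) j

def PsiN (c : SRK m s M) (θ : Mbar M → ℝ) {l : ℕ} (t : STree l m)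
    (i : Fin l) (p : SIdx m M) (q : Fin s) : ℝ := PsiAux c θ t l i p q

/-- the elementary-weight factor contributed by the subtree rooted at a son of the root. -/
def phiFactor (c : SRK m s M) (θ : Mbar M → ℝ) {l : ℕ} (t : STree l m) (i : Fin l) : ℝ :=
  match t.color i with
  | none => ∑ j, c.z θ .det j * ∏ cc ∈ t.child i.succ, PsiN c θ t cc .det j
  | some jj => ∑ μ : M, ∑ j, c.z θ (.sto jj μ) j *
      ∏ cc ∈ t.child i.succ, PsiN c θ t cc (.sto jj μ) j

/-- The elementary weight `Φ_S(t)` of a `γ`-rooted tree. -/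
def PhiS (c : SRK m s M) (θ : Mbar M → ℝ) {l : ℕ} (t : STree l m) : ℝ :=
  ∏ i ∈ t.child 0, phiFactor c θ t i

/-- `∑_{i₁} Z^{(k,ν)}_{i,i₁} Φ_{i₁}(t)` for a tree with root colour `rc`, the sum over
the pair `(j_r,ν_r)` of the root being shared between the `Z`-factor and `Φ`. -/
def ZPhi (c : SRK m s M) (θ : Mbar M → ℝ) (p : SIdx m M) (i : Fin s)
    (rc : Option (Fin m)) {l : ℕ} (t : STree l m) : ℝ :=
  match rc with
  | none => ∑ i1, c.Z θ p .det i i1 * ∏ cc ∈ t.child 0, PsiN c θ t cc .det i1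
  | some jr => ∑ ν : M, ∑ i1, c.Z θ p (.sto jr ν) i i1 *
      ∏ cc ∈ t.child 0, PsiN c θ t cc (.sto jr ν) i1

/-- `∑_{i₁} z_{i₁} Φ_{i₁}(t)` for a tree with root colour `rc`. -/
def zPhi (c : SRK m s M) (θ : Mbar M → ℝ)
    (rc : Option (Fin m)) {l : ℕ} (t : STree l m) : ℝ :=
  match rc with
  | none => ∑ i1, c.z θ .det i1 * ∏ cc ∈ t.child 0, PsiN c θ t cc .det i1
  | some jr => ∑ ν : M, ∑ i1, c.z θ (.sto jr ν) i1 *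
      ∏ cc ∈ t.child 0, PsiN c θ t cc (.sto jr ν) i1

end PhiDefs

/-- `D^q` with increments `Δ` applied to `g` at the point `θ0`:
`∑_{ν₁,…,ν_q ∈ M̄} Δθ_{ν₁}⋯Δθ_{ν_q} ∂^q g/(∂θ_{ν₁}⋯∂θ_{ν_q})(θ0)`. -/
def Dq {ι : Type} [Fintype ι] [DecidableEq ι] {F : Type}
    [NormedAddCommGroup F] [NormedSpace ℝ F]
    (q : ℕ) (Δ : ι → ℝ) (g : (ι → ℝ) → F) (θ0 : ι → ℝ) : F :=
  ∑ νs : Fin q → ι, (∏ r, Δ (νs r)) •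
    iteratedFDeriv ℝ q g θ0 fun r => Pi.single (νs r) 1

/-- `∑_{ν₁,…,ν_q ∈ M̄} ∂^q g/(∂θ_{ν₁}⋯∂θ_{ν_q})(θ0)`. -/
def DerSum {ι : Type} [Fintype ι] [DecidableEq ι] {F : Type}
    [NormedAddCommGroup F] [NormedSpace ℝ F]
    (q : ℕ) (g : (ι → ℝ) → F) (θ0 : ι → ℝ) : F :=
  ∑ νs : Fin q → ι, iteratedFDeriv ℝ q g θ0 fun r => Pi.single (νs r) 1

/-- the space `C_P^l`: `l` times continuously differentiable with all derivatives up
to order `l` of polynomial growth. -/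
def IsCP {d : ℕ} {F : Type} [NormedAddCommGroup F] [NormedSpace ℝ F]
    (l : ℕ) (g : Evec d → F) : Prop :=
  ContDiff ℝ l g ∧ ∀ i : ℕ, i ≤ l → ∃ K > (0:ℝ), ∃ r : ℕ,
    ∀ x, ‖iteratedFDeriv ℝ i g x‖ ≤ K * (1 + ‖x‖ ^ (2*r))

/-- A labelled tree is special if no node except possibly the root has more than one son. -/
def IsSpecial {q : ℕ} (t : STree q 0) : Prop :=
  ∀ i : Fin q, (t.child i.succ).card ≤ 1

instance {q : ℕ} : DecidablePred (IsSpecial (q := q)) := fun t => by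
  unfold IsSpecial; infer_instance

end SRKPaper

namespace SRKPaper

section DirectionalDerivatives

variable {E F : Type*} [NormedAddCommGroup E] [NormedSpace ℝ E]
  [NormedAddCommGroup F] [NormedSpace ℝ F]

universe uE uF in
/-- Differentiating an iterated derivative in a further direction appends that direction. -/
theorem fderiv_iteratedFDeriv_apply_snoc {E : Type uE} [NormedAddCommGroup E] [NormedSpace ℝ E]
    (n : ℕ) : ∀ {F : Type (max uE uF)} [NormedAddCommGroup F] [NormedSpace ℝ F] {f : E → F},
      ContDiff ℝ (n + 1) f → ∀ (x : E) (v : Fin n → E) (w : E),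
      fderiv ℝ (fun y => iteratedFDeriv ℝ n f y v) x w
        = iteratedFDeriv ℝ (n + 1) f x (Fin.snoc v w) := by
  induction n with
  | zero =>
    intro F _ _ f hf x v w
    simp [iteratedFDeriv_succ_apply_right]
    rfl
  | succ n ih =>
    intro F _ _ f hf x v w
    have hf' : ContDiff ℝ (n + 1) (fderiv ℝ f) :=
      hf.fderiv_right (by push_cast; exact le_rfl)
    have hf'' : ContDiff ℝ n (fderiv ℝ (fderiv ℝ f)) := hf'.fderiv_right le_rfl
    have h1 : (fun y => iteratedFDeriv ℝ (n + 1) f y v)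
        = fun y => (iteratedFDeriv ℝ n (fderiv ℝ f) y (Fin.init v)) (v (Fin.last n)) := by
      ext y; rw [iteratedFDeriv_succ_apply_right]
    have hd : DifferentiableAt ℝ
        (fun y => iteratedFDeriv ℝ n (fderiv ℝ f) y (Fin.init v)) x := by
      have : ContDiff ℝ 1 (iteratedFDeriv ℝ n (fderiv ℝ f)) :=
        hf'.iteratedFDeriv_right (by rw [add_comm])
      exact ((this.differentiable one_ne_zero) x).continuousMultilinear_apply_const _
    rw [h1, fderiv_clm_apply hd (by fun_prop)]
    have hsymm : (ContinuousLinearMap.flipₗᵢ ℝ E E F) ∘ fderiv ℝ (fderiv ℝ f)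
        = fderiv ℝ (fderiv ℝ f) := by
      ext y a b
      have : IsSymmSndFDerivAt ℝ f y := by
        apply (hf.contDiffAt (x := y)).isSymmSndFDerivAt
        simp only [minSmoothness_of_isRCLikeNormedField]
        norm_cast
        omega
      exact this.eq b a
    have hflip : ∀ (m : Fin n → E) (a b : E),
        iteratedFDeriv ℝ n (fderiv ℝ (fderiv ℝ f)) x m a b
          = iteratedFDeriv ℝ n (fderiv ℝ (fderiv ℝ f)) x m b a := by
      intro m a b
      conv_lhs => rw [← hsymm]
      have := ContinuousLinearMap.iteratedFDeriv_comp_left (G := E →L[ℝ] E →L[ℝ] F)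
        (ContinuousLinearMap.flipₗᵢ ℝ E E F).toContinuousLinearEquiv.toContinuousLinearMap
        (hf''.contDiffAt (x := x)) (i := n) le_rfl
      have h2 := congrArg (fun T => T m a b) this
      exact h2
    have h3 := ih hf' x (Fin.init v) w
    simp only [fderiv_fun_const, Pi.zero_apply, ContinuousLinearMap.comp_zero, zero_add,
      ContinuousLinearMap.flip_apply]
    rw [h3, iteratedFDeriv_succ_apply_right, iteratedFDeriv_succ_apply_right (n := n + 1),
      iteratedFDeriv_succ_apply_right]
    simp only [Fin.init_snoc, Fin.snoc_last]
    exact hflip _ _ _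

/-- The derivative of `f` in the directions `w c`, `c ∈ C`, listed in increasing order of `c`. -/
def finsetDeriv {N : ℕ} (f : E → F) (C : Finset (Fin N)) (w : Fin N → E) (x : E) : F :=
  iteratedFDeriv ℝ C.card f x fun p => w (C.orderIsoOfFin rfl p).1

variable {N : ℕ}

theorem finsetDeriv_eq_of_strictMono (f : E → F) (C : Finset (Fin N)) (w : Fin N → E) (x : E)
    {p : ℕ} (hp : C.card = p) (e : Fin p → Fin N) (he : StrictMono e) (hC : ∀ i, e i ∈ C) :
    finsetDeriv f C w x = iteratedFDeriv ℝ p f x (w ∘ e) := by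
  subst hp
  have := Finset.orderEmbOfFin_unique rfl hC he
  subst this
  rfl

theorem finsetDeriv_congr (f : E → F) (C : Finset (Fin N)) {w w' : Fin N → E}
    (h : ∀ c ∈ C, w c = w' c) : finsetDeriv f C w = finsetDeriv f C w' := by
  ext x
  unfold finsetDeriv
  congr 1
  ext p
  exact h _ (C.orderIsoOfFin rfl p).2

theorem finsetDeriv_empty (f : E → F) (w : Fin N → E) : finsetDeriv f ∅ w = f := by
  ext x
  rw [finsetDeriv_eq_of_strictMono f ∅ w x (p := 0) rfl Fin.elim0 (fun i => i.elim0)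
    (fun i => i.elim0)]
  simp

theorem contDiff_finsetDeriv {f : E → F} {C : Finset (Fin N)} (w : Fin N → E) {r : ℕ}
    (hf : ContDiff ℝ (r + C.card : ℕ) f) : ContDiff ℝ r (finsetDeriv f C w) := by
  have : ContDiff ℝ r (iteratedFDeriv ℝ C.card f) :=
    hf.iteratedFDeriv_right (by push_cast; exact le_rfl)
  exact (ContinuousMultilinearMap.apply ℝ (fun _ : Fin C.card => E) F
    (fun p => w (C.orderIsoOfFin rfl p).1)).contDiff.comp this

theorem fderiv_finsetDeriv {E F : Type} [NormedAddCommGroup E] [NormedSpace ℝ E]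
    [NormedAddCommGroup F] [NormedSpace ℝ F] {f : E → F} {C : Finset (Fin N)}
    (hf : ContDiff ℝ (C.card + 1) f) {k : Fin N} (hk : ∀ c ∈ C, c < k) (w : Fin N → E) (x v : E) :
    fderiv ℝ (finsetDeriv f C w) x v
      = finsetDeriv f (insert k C) (Function.update w k v) x := by
  have hkC : k ∉ C := fun h => lt_irrefl _ (hk k h)
  rw [finsetDeriv_eq_of_strictMono f (insert k C) _ x (p := C.card + 1)
    (Finset.card_insert_of_notMem hkC) (Fin.snoc (fun p => (C.orderIsoOfFin rfl p).1) k)]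
  · have := fderiv_iteratedFDeriv_apply_snoc C.card hf x
      (fun p => w (C.orderIsoOfFin rfl p).1) v
    refine Eq.trans this ?_
    congr 1
    ext p
    refine Fin.lastCases ?_ (fun q => ?_) p
    · simp
    · have hne : (C.orderIsoOfFin rfl q).1 ≠ k := (hk _ (C.orderIsoOfFin rfl q).2).ne
      simp [-Finset.coe_orderIsoOfFin_apply, Function.update_of_ne hne]
  · intro i j hij
    induction j using Fin.lastCases with
    | last =>
      induction i using Fin.lastCases with
      | last => exact absurd hij (lt_irrefl _)
      | cast i => simpa [-Finset.coe_orderIsoOfFin_apply] using hk _ (C.orderIsoOfFin rfl i).2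
    | cast j =>
      induction i using Fin.lastCases with
      | last => exact absurd hij (not_lt.2 (Fin.le_last _))
      | cast i =>
        simpa [-Finset.coe_orderIsoOfFin_apply] using
          (C.orderIsoOfFin rfl).strictMono (Fin.castSucc_lt_castSucc_iff.1 hij)
  · intro i
    refine Fin.lastCases ?_ (fun q => ?_) i
    · simp
    · simp

theorem finsetDeriv_update_sum {ι : Type*} (I : Finset ι) (f : E → F) {C : Finset (Fin N)}
    {k : Fin N} (hk : k ∈ C) (w : Fin N → E) (a : ι → ℝ) (v : ι → E) (x : E) :
    finsetDeriv f C (Function.update w k (∑ i ∈ I, a i • v i)) x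
      = ∑ i ∈ I, a i • finsetDeriv f C (Function.update w k (v i)) x := by
  have key : ∀ u : E, (fun p => Function.update w k u (C.orderIsoOfFin rfl p).1)
      = Function.update (fun p => w (C.orderIsoOfFin rfl p).1)
          ((C.orderIsoOfFin rfl).symm ⟨k, hk⟩) u := by
    intro u
    ext p
    by_cases hp : p = (C.orderIsoOfFin rfl).symm ⟨k, hk⟩
    · subst hp; simp [-Finset.coe_orderIsoOfFin_apply]
    · rw [Function.update_of_ne hp, Function.update_of_ne]
      intro h
      apply hp
      rw [OrderIso.eq_symm_apply]
      exact Subtype.ext h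
  unfold finsetDeriv
  simp only [key]
  have := (iteratedFDeriv ℝ C.card f x).toMultilinearMap.map_update_sum I
    ((C.orderIsoOfFin rfl).symm ⟨k, hk⟩) (fun i => a i • v i)
    (fun p => w (C.orderIsoOfFin rfl p).1)
  refine this.trans (Finset.sum_congr rfl fun i _ => ?_)
  exact (iteratedFDeriv ℝ C.card f x).map_update_smul _ _ _ _

end DirectionalDerivatives

section Curves

variable {N d : ℕ}

/-- The family of standard basis vectors with indices `w`. -/
def basisDir (w : Fin N → Fin d) (c : Fin N) : Evec d := EuclideanSpace.single (w c) 1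

theorem basisDir_update (w : Fin N → Fin d) (k : Fin N) (i : Fin d) :
    basisDir (Function.update w k i)
      = Function.update (basisDir w) k (EuclideanSpace.single i 1) := by
  ext1 c
  by_cases hc : c = k
  · subst hc; simp [basisDir]
  · simp [basisDir, hc]

theorem Evec.eq_sum_single (v : Evec d) :
    v = ∑ i, v i • (EuclideanSpace.single i (1 : ℝ) : Evec d) := by
  ext j
  simp [Finset.sum_apply, Pi.single_apply]

theorem iteratedDeriv_succ_const_add_id_mul (y : ℝ) {G : ℝ → ℝ} {q : ℕ}
    (hG : ContDiffAt ℝ (q + 1 : ℕ) G 0) :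
    iteratedDeriv (q + 1) (fun u => y + u * G u) 0 = (q + 1 : ℝ) * iteratedDeriv q G 0 := by
  rw [iteratedDeriv_const_add (Nat.succ_pos q), iteratedDeriv_fun_mul contDiffAt_fun_id hG,
    Finset.sum_eq_single 1]
  · simp [iteratedDeriv_fun_id]
  · intro b _ hb
    rw [iteratedDeriv_fun_id]
    simp [hb]
  · simp

theorem iteratedDeriv_succ_finsetDeriv_comp {f : Evec d → Evec d} {h : ℝ → Evec d}
    {C : Finset (Fin N)} {k : Fin N} (hk : ∀ c ∈ C, c < k) {r : ℕ}
    (hf : ContDiff ℝ (r + 1 + C.card : ℕ) f) (hh : ContDiffAt ℝ (r + 1 : ℕ) h 0)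
    (w : Fin N → Fin d) (j : Fin d) :
    iteratedDeriv (r + 1) (fun u => finsetDeriv f C (basisDir w) (h u) j) 0
      = ∑ q ∈ Finset.range (r + 1), (r.choose q : ℝ) *
          ∑ i, iteratedDeriv (r - q)
              (fun u => finsetDeriv f (insert k C) (basisDir (Function.update w k i)) (h u) j) 0
            * iteratedDeriv (q + 1) (fun u => h u i) 0 := by
  have hD : ContDiff ℝ (r + 1 : ℕ) (finsetDeriv f C (basisDir w)) := contDiff_finsetDeriv _ hf
  have hkC : k ∉ C := fun h => lt_irrefl _ (hk k h)
  have hD' : ∀ i, ContDiff ℝ r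
      (finsetDeriv f (insert k C) (basisDir (Function.update w k i))) := fun i =>
    contDiff_finsetDeriv _ (by
      rw [Finset.card_insert_of_notMem hkC]; convert hf using 2; omega)
  have hhd : ∀ᶠ u in nhds (0 : ℝ), DifferentiableAt ℝ h u := by
    have h1 : ContDiffAt ℝ (1 : ℕ) h 0 := hh.of_le (by norm_cast; omega)
    filter_upwards [h1.eventually (by simp)] with u hu
    exact hu.differentiableAt (by simp)
  have hcoord : ∀ i, ContDiffAt ℝ (r + 1 : ℕ) (fun u => h u i) 0 := fun i =>
    (EuclideanSpace.proj (𝕜 := ℝ) i).contDiff.contDiffAt.comp 0 hh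
  have hderiv : ∀ i, ContDiffAt ℝ r (deriv fun u => h u i) 0 := fun i => by
    have h1 := (hcoord i).fderiv_right (m := r) (by push_cast; exact le_rfl)
    have h2 := h1.clm_apply (contDiffAt_const (c := (1 : ℝ)))
    simpa only [fderiv_apply_one_eq_deriv] using h2
  have hcomp : ∀ i, ContDiffAt ℝ r
      (fun u => finsetDeriv f (insert k C) (basisDir (Function.update w k i)) (h u) j) 0 :=
    fun i => (EuclideanSpace.proj (𝕜 := ℝ) j).contDiff.contDiffAt.comp 0
      ((hD' i).contDiffAt.comp 0 (hh.of_le (by norm_cast; omega)))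
  have hev : (deriv fun u => finsetDeriv f C (basisDir w) (h u) j) =ᶠ[nhds 0]
      fun u => ∑ i, deriv (fun u => h u i) u *
        finsetDeriv f (insert k C) (basisDir (Function.update w k i)) (h u) j := by
    filter_upwards [hhd] with u hu
    have h1 : HasDerivAt (fun u => finsetDeriv f C (basisDir w) (h u))
        (fderiv ℝ (finsetDeriv f C (basisDir w)) (h u) (deriv h u)) u :=
      ((hD.differentiable (by simp)) (h u)).hasFDerivAt.comp_hasDerivAt u hu.hasDerivAt
    have h2 : HasDerivAt (fun u => finsetDeriv f C (basisDir w) (h u) j)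
        (fderiv ℝ (finsetDeriv f C (basisDir w)) (h u) (deriv h u) j) u :=
      (EuclideanSpace.proj (𝕜 := ℝ) j).hasFDerivAt.comp_hasDerivAt u h1
    have h3 : ∀ i, deriv (fun u => h u i) u = deriv h u i := fun i =>
      ((EuclideanSpace.proj (𝕜 := ℝ) i).hasFDerivAt.comp_hasDerivAt u hu.hasDerivAt).deriv
    rw [h2.deriv, fderiv_finsetDeriv (hf.of_le (by norm_cast; omega)) hk,
      Evec.eq_sum_single (deriv h u), finsetDeriv_update_sum _ _ (Finset.mem_insert_self _ _)]
    simp [basisDir_update, h3]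
  rw [iteratedDeriv_succ', hev.iteratedDeriv_eq, iteratedDeriv_fun_sum
    fun i _ => (hderiv i).mul (hcomp i)]
  simp_rw [iteratedDeriv_fun_mul (hderiv _) (hcomp _), Finset.mul_sum]
  rw [Finset.sum_comm]
  refine Finset.sum_congr rfl fun q _ => Finset.sum_congr rfl fun i _ => ?_
  rw [iteratedDeriv_succ']
  ring

end Curves

section Growth

variable {N : ℕ} {K J : Type}

/-- The sons of `v` among the first `k` nonroot nodes. -/
def liveSons (g : Fin N → Fin (N + 1)) (k : ℕ) (v : Fin (N + 1)) : Finset (Fin N) :=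
  Finset.univ.filter fun i => i.val < k ∧ g i = v

/-- The sons of `v` among the remaining nonroot nodes. -/
def pendingSons (g : Fin N → Fin (N + 1)) (k : ℕ) (v : Fin (N + 1)) : Finset (Fin N) :=
  Finset.univ.filter fun i => k ≤ i.val ∧ g i = v

/-- A decoration of the nonroot nodes together with the decoration of the root. -/
def nodeLabel (root : K × J) (dec : Fin N → K × J) : Fin (N + 1) → K × J := Fin.cons root dec

/-- The father maps of partially grown trees: nodes with index at least `k` are leaves. -/
def growthStates (N k : ℕ) : Finset (Fin N → Fin (N + 1)) :=
  Finset.univ.filter fun g => ∀ i, (g i).val ≤ i.val ∧ (g i).val ≤ k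

/-- Make the nodes in `C` sons of the node `k`. -/
def graft (g : Fin N → Fin (N + 1)) (k : Fin N) (C : Finset (Fin N)) (i : Fin N) : Fin (N + 1) :=
  if i ∈ C then k.succ else g i

/-- The later brothers of the node `k`. -/
def laterBrothers (g : Fin N → Fin (N + 1)) (k : Fin N) : Finset (Fin N) :=
  Finset.univ.filter fun i => k < i ∧ g i = g k

theorem nodeLabel_update (root : K × J) (dec : Fin N → K × J) (k : Fin N) (x : K × J)
    {v : Fin (N + 1)} (hv : v.val ≤ k.val) :
    nodeLabel root (Function.update dec k x) v = nodeLabel root dec v := by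
  unfold nodeLabel
  induction v using Fin.cases with
  | zero => simp
  | succ i =>
    have : i ≠ k := by rintro rfl; simp at hv
    simp [this]

theorem mem_growthStates {k : ℕ} {g : Fin N → Fin (N + 1)} :
    g ∈ growthStates N k ↔ ∀ i, (g i).val ≤ i.val ∧ (g i).val ≤ k := by
  simp [growthStates]

section Graft

variable {g : Fin N → Fin (N + 1)} {k : Fin N} {C : Finset (Fin N)}

theorem graft_of_le (hC : C ⊆ laterBrothers g k) {i : Fin N} (hi : i ≤ k) :
    graft g k C i = g i := by
  rw [graft, if_neg]
  intro h
  have := hC h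
  simp only [laterBrothers, Finset.mem_filter] at this
  exact absurd this.2.1 (not_lt.2 hi)

theorem graft_mem (hg : g ∈ growthStates N k) (hC : C ⊆ laterBrothers g k) :
    graft g k C ∈ growthStates N (k + 1) := by
  rw [mem_growthStates] at hg ⊢
  intro i
  unfold graft
  split_ifs with h
  · have := hC h
    simp only [laterBrothers, Finset.mem_filter] at this
    exact ⟨by simpa using this.2.1, by simp⟩
  · exact ⟨(hg i).1, (hg i).2.trans (Nat.le_succ _)⟩

theorem graft_eq_iff {v : Fin (N + 1)} (hv : v ≠ k.succ)
    (i : Fin N) : graft g k C i = v ↔ i ∉ C ∧ g i = v := by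
  unfold graft
  split_ifs with h <;> simp [h, hv.symm]

theorem graft_eq_succ_iff (hg : g ∈ growthStates N k) (i : Fin N) :
    graft g k C i = k.succ ↔ i ∈ C := by
  unfold graft
  split_ifs with h
  · simp [h]
  · simp only [h, iff_false]
    intro h'
    have := (mem_growthStates.1 hg i).2
    rw [h'] at this
    simp at this

variable {sz : (Fin N → Fin (N + 1)) → Fin N → ℕ}
  (hsz : ∀ g : Fin N → Fin (N + 1), (∀ i, (g i).val ≤ i.val) →
    ∀ i, sz g i = 1 + ∑ c with g c = i.succ, sz g c)

include hsz in
theorem size_of_leaf {k : ℕ} (hg : g ∈ growthStates N k) {i : Fin N} (hi : k ≤ i.val) :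
    sz g i = 1 := by
  rw [mem_growthStates] at hg
  rw [hsz g (fun i => (hg i).1), Finset.filter_false_of_mem]
  · simp
  · intro c _ h
    have := (hg c).2
    rw [h] at this
    simp at this
    omega

include hsz in
theorem size_graft_self (hg : g ∈ growthStates N k) (hC : C ⊆ laterBrothers g k) :
    sz (graft g k C) k = 1 + C.card := by
  have hg' := graft_mem hg hC
  rw [hsz _ (fun i => (mem_growthStates.1 hg' i).1)]
  simp only [graft_eq_succ_iff hg, Finset.filter_univ_mem]
  rw [Finset.sum_congr rfl (g := fun _ => 1)]
  · simp
  · intro c hc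
    have := hC hc
    simp only [laterBrothers, Finset.mem_filter] at this
    exact size_of_leaf hsz hg' this.2.1

include hsz in
theorem size_graft_of_lt (hg : g ∈ growthStates N k) (hC : C ⊆ laterBrothers g k)
    {i : Fin N} (hi : i < k) : sz (graft g k C) i = sz g i := by
  have hg' := graft_mem hg hC
  have hgm := fun i => (mem_growthStates.1 hg i).1
  have hsons : ∀ c, graft g k C c = i.succ ↔ c ∉ C ∧ g c = i.succ :=
    graft_eq_iff (by simpa using hi.ne)
  have hson : ∀ c, c ≠ k → g c = i.succ → sz (graft g k C) c = sz g c := by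
    intro c hck hc
    rcases lt_or_gt_of_ne hck with h | h
    · have hic : i < c := by
        have := hgm c
        rw [hc] at this
        simpa using this
      exact size_graft_of_lt hg hC h
    · rw [size_of_leaf hsz hg' (by exact h), size_of_leaf hsz hg (by exact h.le)]
  rw [hsz _ (fun i => (mem_growthStates.1 hg' i).1), hsz g hgm]
  congr 1
  by_cases hk : g k = i.succ
  · have hkC : k ∉ C := fun h => by
      have := hC h
      simp [laterBrothers] at this
    have hsplit : (Finset.univ.filter fun c => g c = i.succ)
        = (Finset.univ.filter fun c => graft g k C c = i.succ).disjUnion C (by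
          rw [Finset.disjoint_left]
          intro c hc
          rw [Finset.mem_filter, hsons] at hc
          exact hc.2.1) := by
      ext c
      simp only [Finset.mem_filter, Finset.mem_univ, true_and, Finset.mem_disjUnion, hsons]
      constructor
      · intro h
        by_cases hc : c ∈ C <;> simp [h, hc]
      · rintro (h | h)
        · exact h.2
        · have := hC h
          simp only [laterBrothers, Finset.mem_filter] at this
          rw [this.2.2, hk]
    rw [hsplit, Finset.sum_disjUnion]
    have hkm : k ∈ Finset.univ.filter fun c => graft g k C c = i.succ := by
      simp [hsons, hk, hkC]
    rw [← Finset.add_sum_erase _ _ hkm, ← Finset.add_sum_erase _ (sz g) hkm,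
      size_graft_self hsz hg hC, size_of_leaf hsz hg le_rfl,
      Finset.sum_congr rfl (g := fun _ => 1) (s₁ := C)]
    · rw [Finset.sum_congr rfl (g := sz g)]
      · simp only [Finset.sum_const, smul_eq_mul, mul_one]
        ring
      · intro c hc
        rw [Finset.mem_erase, Finset.mem_filter, hsons] at hc
        exact hson c hc.1 hc.2.2.2
    · intro c hc
      have := hC hc
      simp only [laterBrothers, Finset.mem_filter] at this
      exact size_of_leaf hsz hg this.2.1.le
  · have : ∀ c, graft g k C c = i.succ ↔ g c = i.succ := by
      intro c
      rw [hsons]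
      constructor
      · exact fun h => h.2
      · intro h
        refine ⟨fun hc => hk ?_, h⟩
        have := hC hc
        simp only [laterBrothers, Finset.mem_filter] at this
        rw [← this.2.2, h]
    simp only [this]
    refine Finset.sum_congr rfl fun c hc => hson c ?_ (by simpa using hc)
    rintro rfl
    exact hk (by simpa using hc)
termination_by N - i.val
decreasing_by
  have := c.isLt
  simp only [Fin.lt_def] at hic
  omega

end Graft

variable (A : K → J → Finset (Fin N) → (Fin N → J) → ℕ → ℝ) (W : K → K → ℝ)
  (sz : (Fin N → Fin (N + 1)) → Fin N → ℕ)

/-- The factor contributed by the node `v` of a partially grown tree. -/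
def nodeFactor (root : K × J) (g : Fin N → Fin (N + 1)) (dec : Fin N → K × J) (k : ℕ)
    (v : Fin (N + 1)) : ℝ :=
  A (nodeLabel root dec v).1 (nodeLabel root dec v).2 (liveSons g k v) (fun i => (dec i).2)
    (pendingSons g k v).card

/-- The weight of a decorated tree of which only the first `k` nonroot nodes are grown. -/
def growthWeight (root : K × J) (g : Fin N → Fin (N + 1)) (dec : Fin N → K × J) (k : ℕ) : ℝ :=
  (∏ i with i.val < k, (sz g i : ℝ) * W (nodeLabel root dec (g i)).1 (dec i).1) *
    ∏ v with v.val ≤ k, nodeFactor A root g dec k v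

variable {A W sz}
  (hcongr : ∀ P j C w w' r, (∀ c ∈ C, w c = w' c) → A P j C w r = A P j C w' r)
  (hsz : ∀ g : Fin N → Fin (N + 1), (∀ i, (g i).val ≤ i.val) →
    ∀ i, sz g i = 1 + ∑ c with g c = i.succ, sz g c)

include hcongr hsz in
theorem growthWeight_graft (root : K × J) {g : Fin N → Fin (N + 1)} {k : Fin N}
    {C : Finset (Fin N)} (hg : g ∈ growthStates N k) (hC : C ⊆ laterBrothers g k)
    (dec : Fin N → K × J) (x : K × J) :
    growthWeight A W sz root (graft g k C) (Function.update dec k x) (k + 1)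
      = (∏ i with i.val < k.val, (sz g i : ℝ) * W (nodeLabel root dec (g i)).1 (dec i).1) *
        (∏ v ∈ (Finset.univ.filter fun v : Fin (N + 1) => v.val ≤ k.val).erase (g k),
          nodeFactor A root g dec k v) *
        (A (nodeLabel root dec (g k)).1 (nodeLabel root dec (g k)).2
          (insert k (liveSons g k (g k))) (Function.update (fun i => (dec i).2) k x.2)
          ((laterBrothers g k).card - C.card) *
        ((C.card + 1 : ℝ) * (W (nodeLabel root dec (g k)).1 x.1 *
          A x.1 x.2 ∅ (fun i => (dec i).2) C.card))) := by
  have hgm := mem_growthStates.1 hg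
  have hw : (fun i => (Function.update dec k x i).2)
      = Function.update (fun i => (dec i).2) k x.2 := by
    ext i
    by_cases hi : i = k
    · subst hi; simp
    · simp [hi]
  have hf1 : (Finset.univ.filter fun i : Fin N => i.val < k.val + 1)
      = insert k (Finset.univ.filter fun i : Fin N => i.val < k.val) := by
    ext i; simp [Fin.ext_iff]; omega
  have hf2 : (Finset.univ.filter fun v : Fin (N + 1) => v.val ≤ k.val + 1)
      = insert k.succ (Finset.univ.filter fun v : Fin (N + 1) => v.val ≤ k.val) := by
    ext i; simp [Fin.ext_iff]; omega
  have hkC : k ∉ C := fun h => by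
    have := hC h
    simp [laterBrothers] at this
  have hP : ∀ i ∈ C, k < i ∧ g i = g k := fun i hi => by
    simpa [laterBrothers] using hC hi
  have hgk : g k ≠ k.succ := fun h => by have := (hgm k).1; rw [h] at this; simp at this
  have e1 : ∏ i with i.val < k.val, (sz (graft g k C) i : ℝ) *
        W (nodeLabel root (Function.update dec k x) (graft g k C i)).1
          (Function.update dec k x i).1
      = ∏ i with i.val < k.val, (sz g i : ℝ) * W (nodeLabel root dec (g i)).1 (dec i).1 := by
    refine Finset.prod_congr rfl fun i hi => ?_
    have hi : i < k := by simpa using hi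
    rw [size_graft_of_lt hsz hg hC hi, graft_of_le hC hi.le,
      nodeLabel_update _ _ _ _ ((hgm i).2), Function.update_of_ne hi.ne]
  have e2 : nodeFactor A root (graft g k C) (Function.update dec k x) (k + 1) k.succ
      = A x.1 x.2 ∅ (fun i => (dec i).2) C.card := by
    have h1 : liveSons (graft g k C) (k + 1) k.succ = ∅ := by
      simp only [liveSons, graft_eq_succ_iff hg, Finset.filter_eq_empty_iff, Finset.mem_univ,
        forall_const]
      rintro i ⟨hi, hiC⟩
      have := (hP i hiC).1
      simp only [Fin.lt_def] at this
      omega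
    have h2 : pendingSons (graft g k C) (k + 1) k.succ = C := by
      ext i
      simp only [pendingSons, graft_eq_succ_iff hg, Finset.mem_filter, Finset.mem_univ, true_and]
      exact ⟨fun h => h.2, fun h => ⟨(hP i h).1, h⟩⟩
    rw [nodeFactor, h1, h2]
    simp only [nodeLabel, Fin.cons_succ, Function.update_self]
    exact hcongr _ _ _ _ _ _ (by simp)
  have e3 : nodeFactor A root (graft g k C) (Function.update dec k x) (k + 1) (g k)
      = A (nodeLabel root dec (g k)).1 (nodeLabel root dec (g k)).2
          (insert k (liveSons g k (g k))) (Function.update (fun i => (dec i).2) k x.2)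
          ((laterBrothers g k).card - C.card) := by
    have h1 : liveSons (graft g k C) (k + 1) (g k) = insert k (liveSons g k (g k)) := by
      ext i
      simp only [liveSons, graft_eq_iff hgk, Finset.mem_filter, Finset.mem_univ, true_and,
        Finset.mem_insert]
      constructor
      · rintro ⟨h, -, h'⟩
        rcases Nat.lt_succ_iff_lt_or_eq.1 h with h | h
        · exact Or.inr ⟨h, h'⟩
        · exact Or.inl (Fin.ext h)
      · rintro (rfl | ⟨h, h'⟩)
        · exact ⟨by omega, hkC, rfl⟩
        · refine ⟨by omega, fun hi => ?_, h'⟩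
          have := (hP i hi).1
          simp only [Fin.lt_def] at this
          omega
    have h2 : pendingSons (graft g k C) (k + 1) (g k) = laterBrothers g k \ C := by
      ext i
      simp only [pendingSons, graft_eq_iff hgk, Finset.mem_filter, Finset.mem_univ, true_and,
        Finset.mem_sdiff, laterBrothers, Fin.lt_def, Nat.succ_le_iff]
      tauto
    rw [nodeFactor, h1, h2, nodeLabel_update _ _ _ _ ((hgm k).1), hw,
      Finset.card_sdiff_of_subset hC]
  have e4 : ∏ v ∈ (Finset.univ.filter fun v : Fin (N + 1) => v.val ≤ k.val).erase (g k),
        nodeFactor A root (graft g k C) (Function.update dec k x) (k + 1) v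
      = ∏ v ∈ (Finset.univ.filter fun v : Fin (N + 1) => v.val ≤ k.val).erase (g k),
        nodeFactor A root g dec k v := by
    refine Finset.prod_congr rfl fun v hv => ?_
    rw [Finset.mem_erase, Finset.mem_filter] at hv
    obtain ⟨hne, -, hvk⟩ := hv
    have hvs : v ≠ k.succ := by rintro rfl; simp at hvk
    have hnC : ∀ i, g i = v → i ∉ C ∧ i ≠ k := by
      rintro i rfl
      exact ⟨fun h => hne (hP i h).2, by rintro rfl; exact hne rfl⟩
    have h1 : liveSons (graft g k C) (k + 1) v = liveSons g k v := by
      ext i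
      simp only [liveSons, graft_eq_iff hvs, Finset.mem_filter, Finset.mem_univ, true_and]
      constructor
      · rintro ⟨h, -, h'⟩
        have := Fin.val_ne_of_ne (hnC i h').2
        exact ⟨by omega, h'⟩
      · rintro ⟨h, h'⟩
        exact ⟨by omega, (hnC i h').1, h'⟩
    have h2 : pendingSons (graft g k C) (k + 1) v = pendingSons g k v := by
      ext i
      simp only [pendingSons, graft_eq_iff hvs, Finset.mem_filter, Finset.mem_univ, true_and]
      constructor
      · rintro ⟨h, -, h'⟩
        exact ⟨by omega, h'⟩
      · rintro ⟨h, h'⟩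
        have := Fin.val_ne_of_ne (hnC i h').2
        exact ⟨by omega, (hnC i h').1, h'⟩
    rw [nodeFactor, nodeFactor, h1, h2, nodeLabel_update _ _ _ _ hvk, hw]
    refine hcongr _ _ _ _ _ _ fun c hc => ?_
    rw [Function.update_of_ne]
    rintro rfl
    simp [liveSons] at hc
  have hmem : g k ∈ Finset.univ.filter fun v : Fin (N + 1) => v.val ≤ k.val := by
    simpa using (hgm k).1
  rw [growthWeight, hf1, hf2, Finset.prod_insert (by simp), Finset.prod_insert (by simp),
    ← Finset.mul_prod_erase _ _ hmem, e1, e2, e3, e4, size_graft_self hsz hg hC,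
    graft_of_le hC le_rfl, nodeLabel_update _ _ _ _ ((hgm k).1), Function.update_self]
  push_cast
  ring

variable [Fintype K] [Fintype J]
  (hA : ∀ P j C k w r, (∀ c ∈ C, c < k) → C.card + r + 1 ≤ N →
    A P j C w (r + 1) = ∑ q ∈ Finset.range (r + 1), (r.choose q : ℝ) *
      ∑ i, A P j (insert k C) (Function.update w k i) (r - q) *
        ((q + 1 : ℝ) * ∑ Q, W P Q * A Q i ∅ w q))

include hcongr hsz hA in
theorem growthWeight_eq_sum (root : K × J) {g : Fin N → Fin (N + 1)} {k : Fin N}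
    (hg : g ∈ growthStates N k) (dec : Fin N → K × J) :
    growthWeight A W sz root g dec k
      = ∑ C ∈ (laterBrothers g k).powerset, ∑ x : K × J,
          growthWeight A W sz root (graft g k C) (Function.update dec k x) (k + 1) := by
  have hmem : g k ∈ Finset.univ.filter fun v : Fin (N + 1) => v.val ≤ k.val := by
    simpa using (mem_growthStates.1 hg k).1
  have hkP : k ∉ laterBrothers g k := by simp [laterBrothers]
  have hpend : pendingSons g k (g k) = insert k (laterBrothers g k) := by
    ext i
    simp only [pendingSons, laterBrothers, Finset.mem_filter, Finset.mem_univ, true_and,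
      Finset.mem_insert]
    constructor
    · rintro ⟨h, h'⟩
      rcases h.eq_or_lt with h | h
      · exact Or.inl (Fin.ext h.symm)
      · exact Or.inr ⟨h, h'⟩
    · rintro (rfl | ⟨h, h'⟩)
      · exact ⟨le_rfl, rfl⟩
      · exact ⟨h.le, h'⟩
  have hlt : ∀ c ∈ liveSons g k (g k), c < k := by
    intro c hc
    simp only [liveSons, Finset.mem_filter] at hc
    exact hc.2.1
  have hcard : (liveSons g k (g k)).card + (laterBrothers g k).card + 1 ≤ N := by
    rw [add_assoc, ← Finset.card_insert_of_notMem hkP, ← Finset.card_union_of_disjoint]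
    · simpa using Finset.card_le_univ (liveSons g k (g k) ∪ insert k (laterBrothers g k))
    · rw [Finset.disjoint_left]
      intro c hc hc'
      have h1 := hlt c hc
      rw [← hpend] at hc'
      simp only [pendingSons, Finset.mem_filter] at hc'
      exact absurd h1 (not_lt.2 hc'.2.1)
  rw [growthWeight, ← Finset.mul_prod_erase _ _ hmem]
  conv_lhs => rw [nodeFactor, hpend, Finset.card_insert_of_notMem hkP,
    hA _ _ _ k _ _ hlt hcard]
  set G : ℕ → ℝ := fun q => ∑ i, A (nodeLabel root dec (g k)).1
    (nodeLabel root dec (g k)).2 (insert k (liveSons g k (g k)))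
    (Function.update (fun i => (dec i).2) k i) ((laterBrothers g k).card - q) *
      ((q + 1 : ℝ) * ∑ Q, W (nodeLabel root dec (g k)).1 Q * A Q i ∅ (fun i => (dec i).2) q)
    with hG
  have hsum : ∑ q ∈ Finset.range ((laterBrothers g k).card + 1),
      ((laterBrothers g k).card.choose q : ℝ) * G q
        = ∑ C ∈ (laterBrothers g k).powerset, G C.card := by
    rw [Finset.sum_powerset_apply_card]
    simp [nsmul_eq_mul]
  rw [hsum, Finset.sum_mul, Finset.mul_sum]
  refine Finset.sum_congr rfl fun C hC => ?_
  rw [Finset.sum_congr rfl fun x _ =>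
    growthWeight_graft hcongr hsz root hg (Finset.mem_powerset.1 hC) dec x, ← Finset.mul_sum,
    mul_comm (G C.card), ← mul_assoc]
  congr 1
  rw [hG, Fintype.sum_prod_type_right]
  simp only [Finset.mul_sum]

/-- Decorations that are trivial on the nodes with index at least `k`. -/
def growthDecorations [DecidableEq K] [DecidableEq J] (root : K × J) (k : ℕ) :
    Finset (Fin N → K × J) :=
  Finset.univ.filter fun dec => ∀ i, k ≤ i.val → dec i = root

theorem sum_growthDecorations_succ [DecidableEq K] [DecidableEq J] (root : K × J) (k : Fin N)
    {α : Type*} [AddCommMonoid α] (X : (Fin N → K × J) → α) :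
    ∑ dec ∈ growthDecorations root (k.val + 1), X dec
      = ∑ dec ∈ growthDecorations root k.val, ∑ x : K × J, X (Function.update dec k x) := by
  rw [← Finset.sum_product']
  symm
  refine Finset.sum_bij' (fun p _ => Function.update p.1 k p.2)
    (fun dec _ => (Function.update dec k root, dec k)) ?_ ?_ ?_ ?_ ?_
  · rintro ⟨dec, x⟩ h
    simp only [growthDecorations, Finset.mem_product, Finset.mem_filter, Finset.mem_univ,
      true_and, and_true] at h ⊢
    intro i hi
    rw [Function.update_of_ne (by rintro rfl; omega)]
    exact h i (by omega)
  · intro dec h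
    simp only [growthDecorations, Finset.mem_product, Finset.mem_filter, Finset.mem_univ,
      true_and, and_true] at h ⊢
    intro i hi
    by_cases hik : i = k
    · subst hik; simp
    · rw [Function.update_of_ne hik]
      have := Fin.val_ne_of_ne hik
      exact h i (by omega)
  · rintro ⟨dec, x⟩ h
    simp only [growthDecorations, Finset.mem_product, Finset.mem_filter, Finset.mem_univ,
      true_and, and_true] at h
    simp [← h k le_rfl]
  · intro dec h
    simp
  · intro p h
    rfl

theorem sum_growthStates_succ (k : Fin N) {α : Type*} [AddCommMonoid α]
    (X : (Fin N → Fin (N + 1)) → α) :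
    ∑ g ∈ growthStates N (k.val + 1), X g
      = ∑ g ∈ growthStates N k.val, ∑ C ∈ (laterBrothers g k).powerset, X (graft g k C) := by
  have hk : ∀ g ∈ growthStates N (k.val + 1), g k ≠ k.succ := fun g hg h => by
    have := (mem_growthStates.1 hg k).1
    rw [h] at this
    simp at this
  rw [Finset.sum_sigma']
  symm
  refine Finset.sum_bij' (fun p _ => graft p.1 k p.2)
    (fun g _ => ⟨fun i => if g i = k.succ then g k else g i,
      Finset.univ.filter fun i => g i = k.succ⟩) ?_ ?_ ?_ ?_ ?_
  · rintro ⟨g, C⟩ h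
    simp only [Finset.mem_sigma, Finset.mem_powerset] at h
    exact graft_mem h.1 h.2
  · intro g hg
    have hgm := mem_growthStates.1 hg
    simp only [Finset.mem_sigma, Finset.mem_powerset, mem_growthStates]
    refine ⟨fun i => ?_, fun i hi => ?_⟩
    · split_ifs with h
      · have h1 := (hgm i).1
        have h2 := (hgm k).1
        rw [h] at h1
        simp at h1
        omega
      · refine ⟨(hgm i).1, ?_⟩
        have h1 := (hgm i).2
        have h2 := Fin.val_ne_of_ne h
        simp at h2
        omega
    · have hi : g i = k.succ := by simpa using hi
      simp only [laterBrothers, Finset.mem_filter, Finset.mem_univ, true_and, hi, if_true,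
        if_neg (hk g hg), and_true]
      have h1 := (hgm i).1
      rw [hi] at h1
      simpa [Nat.succ_le_iff] using h1
  · rintro ⟨g, C⟩ h
    simp only [Finset.mem_sigma, Finset.mem_powerset] at h
    obtain ⟨hg, hC⟩ := h
    have h1 : (Finset.univ.filter fun i => graft g k C i = k.succ) = C := by
      ext i; simp [graft_eq_succ_iff hg]
    have h2 : (fun i => if graft g k C i = k.succ then graft g k C k else graft g k C i) = g := by
      ext1 i
      simp only [graft_eq_succ_iff hg, graft_of_le hC le_rfl]
      split_ifs with hi
      · have := hC hi
        simp only [laterBrothers, Finset.mem_filter] at this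
        exact this.2.2.symm
      · simp [graft, hi]
    simp only [h1, h2]
  · intro g hg
    ext1 i
    by_cases h : g i = k.succ <;> simp [graft, h]
  · intro p h
    rfl

include hcongr hsz hA in
/-- Expansion of an `N`-fold derivative over the decorated monotonically labelled trees. -/
theorem sum_growthWeight (root : K × J) :
    A root.1 root.2 ∅ (fun _ => root.2) N
      = ∑ g with ∀ i : Fin N, (g i).val ≤ i.val, ∑ dec : Fin N → K × J,
          (∏ i, (sz g i : ℝ) * W (nodeLabel root dec (g i)).1 (dec i).1) *
          ∏ v, A (nodeLabel root dec v).1 (nodeLabel root dec v).2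
            (Finset.univ.filter fun i => g i = v) (fun i => (dec i).2) 0 := by
  classical
  have hstep : ∀ k ≤ N, ∑ g ∈ growthStates N 0, ∑ dec ∈ growthDecorations root 0,
        growthWeight A W sz root g dec 0
      = ∑ g ∈ growthStates N k, ∑ dec ∈ growthDecorations root k,
        growthWeight A W sz root g dec k := by
    intro k
    induction k with
    | zero => intro _; rfl
    | succ k ih =>
      intro hk
      rw [ih (by omega)]
      have h1 := sum_growthStates_succ (α := ℝ) (⟨k, hk⟩ : Fin N)
        (fun g => ∑ dec ∈ growthDecorations root (k + 1), growthWeight A W sz root g dec (k + 1))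
      refine Eq.trans ?_ h1.symm
      refine Finset.sum_congr rfl fun g hg => ?_
      rw [Finset.sum_congr rfl fun dec _ =>
        growthWeight_eq_sum hcongr hsz hA root (k := ⟨k, hk⟩) hg dec, Finset.sum_comm]
      refine Finset.sum_congr rfl fun C _ => ?_
      exact (sum_growthDecorations_succ (α := ℝ) root (⟨k, hk⟩ : Fin N)
        (fun dec => growthWeight A W sz root (graft g ⟨k, hk⟩ C) dec (k + 1))).symm
  have h0 := hstep N le_rfl
  have hs0 : growthStates N 0 = {fun _ => 0} := by
    ext g
    simp only [mem_growthStates, Finset.mem_singleton]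
    constructor
    · intro h; ext i; simpa using (h i).2
    · rintro rfl; simp
  have hd0 : (growthDecorations root 0 : Finset (Fin N → K × J)) = {fun _ => root} := by
    ext dec
    simp [growthDecorations, funext_iff]
  have hdN : (growthDecorations root N : Finset (Fin N → K × J)) = Finset.univ := by
    ext dec
    simp only [growthDecorations, Finset.mem_filter, Finset.mem_univ, true_and, iff_true]
    intro i hi
    omega
  have hsN : growthStates N N = Finset.univ.filter fun g => ∀ i : Fin N, (g i).val ≤ i.val := by
    ext g
    simp only [mem_growthStates, Finset.mem_filter, Finset.mem_univ, true_and]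
    exact forall_congr' fun i => ⟨fun h => h.1, fun h => ⟨h, by omega⟩⟩
  have hv0 : (Finset.univ.filter fun v : Fin (N + 1) => v.val ≤ 0) = {0} := by
    ext v
    rw [Finset.mem_filter_univ, Finset.mem_singleton, Fin.ext_iff, Fin.val_zero, Nat.le_zero]
  rw [hs0, hd0, hsN, hdN, Finset.sum_singleton, Finset.sum_singleton, growthWeight, hv0] at h0
  have hl : liveSons (fun _ : Fin N => (0 : Fin (N + 1))) 0 0 = ∅ := by simp [liveSons]
  have hp : (pendingSons (fun _ : Fin N => (0 : Fin (N + 1))) 0 0).card = N := by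
    rw [pendingSons, Finset.filter_true_of_mem (fun i _ => ⟨Nat.zero_le _, rfl⟩),
      Finset.card_univ, Fintype.card_fin]
  rw [Finset.prod_singleton, nodeFactor, hl, hp, Finset.filter_false_of_mem (by simp),
    Finset.prod_empty, one_mul] at h0
  refine Eq.trans ?_ (h0.trans ?_)
  · rfl
  refine Finset.sum_congr rfl fun g _ => Finset.sum_congr rfl fun dec _ => ?_
  have hi : (Finset.univ.filter fun i : Fin N => i.val < N) = Finset.univ := by
    ext i; simp
  have hv : (Finset.univ.filter fun v : Fin (N + 1) => v.val ≤ N) = Finset.univ := by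
    ext v; simp; omega
  have hlN : ∀ v, liveSons g N v = Finset.univ.filter fun i => g i = v := by
    intro v; simp [liveSons]
  have hpN : ∀ v, pendingSons g N v = ∅ := by
    intro v
    simp only [pendingSons, Finset.filter_eq_empty_iff, Finset.mem_univ, forall_const]
    intro i h
    omega
  simp only [growthWeight, hi, hv, nodeFactor, hlN, hpN, Finset.card_empty]

end Growth

section Elimination

variable {N : ℕ} {K : Type} [Fintype K] (f : K → Evec d → Evec d) (y : Evec d)
  (W : Fin N → K → K → ℝ) (V : Fin N → K → Evec d) (root : K × Fin d)
  (g : Fin N → Fin (N + 1))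

/-- The weight of a decorated tree whose nodes with index at least `k` are summed out. -/
def eliminationWeight (k : ℕ) (dec : Fin N → K × Fin d) : ℝ :=
  (∏ i with i.val < k, W i (nodeLabel root dec (g i)).1 (dec i).1) *
    ∏ v with v.val ≤ k, finsetDeriv (f (nodeLabel root dec v).1)
      (Finset.univ.filter fun i => g i = v)
      (fun c => if c.val < k then EuclideanSpace.single (dec c).2 1
        else V c (nodeLabel root dec v).1) y (nodeLabel root dec v).2

variable {f y W V g}

theorem sum_eliminationWeight_update (hg : ∀ i, (g i).val ≤ i.val)
    (hV : ∀ i P, V i P = ∑ Q, W i P Q •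
      finsetDeriv (f Q) (Finset.univ.filter fun c => g c = i.succ) (fun c => V c Q) y)
    (k : Fin N) (dec : Fin N → K × Fin d) :
    ∑ x : K × Fin d, eliminationWeight f y W V root g (k + 1) (Function.update dec k x)
      = eliminationWeight f y W V root g k dec := by
  have hf1 : (Finset.univ.filter fun i : Fin N => i.val < k.val + 1)
      = insert k (Finset.univ.filter fun i : Fin N => i.val < k.val) := by
    ext i; simp [Fin.ext_iff]; omega
  have hf2 : (Finset.univ.filter fun v : Fin (N + 1) => v.val ≤ k.val + 1)
      = insert k.succ (Finset.univ.filter fun v : Fin (N + 1) => v.val ≤ k.val) := by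
    ext i; simp [Fin.ext_iff]; omega
  have hmem : g k ∈ Finset.univ.filter fun v : Fin (N + 1) => v.val ≤ k.val := by
    simpa using hg k
  set P := (nodeLabel root dec (g k)).1 with hP
  set w : Fin N → Evec d := fun c => if c.val < k.val then EuclideanSpace.single (dec c).2 1
        else V c P with hw
  have hx : ∀ x : K × Fin d,
      eliminationWeight f y W V root g (k + 1) (Function.update dec k x)
        = ((∏ i with i.val < k.val, W i (nodeLabel root dec (g i)).1 (dec i).1) *
          ∏ v ∈ (Finset.univ.filter fun v : Fin (N + 1) => v.val ≤ k.val).erase (g k),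
            finsetDeriv (f (nodeLabel root dec v).1) (Finset.univ.filter fun i => g i = v)
            (fun c => if c.val < k then EuclideanSpace.single (dec c).2 1
              else V c (nodeLabel root dec v).1) y (nodeLabel root dec v).2) *
          ((W k P x.1 * finsetDeriv (f x.1) (Finset.univ.filter fun c => g c = k.succ)
              (fun c => V c x.1) y x.2) *
            finsetDeriv (f P) (Finset.univ.filter fun i => g i = g k)
              (Function.update w k (EuclideanSpace.single x.2 1)) y
              (nodeLabel root dec (g k)).2) := by
    intro x
    have e1 : ∏ i with i.val < k.val,
          W i (nodeLabel root (Function.update dec k x) (g i)).1 (Function.update dec k x i).1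
        = ∏ i with i.val < k.val, W i (nodeLabel root dec (g i)).1 (dec i).1 := by
      refine Finset.prod_congr rfl fun i hi => ?_
      have hi : i < k := by simpa using hi
      rw [nodeLabel_update _ _ _ _ ((hg i).trans hi.le), Function.update_of_ne hi.ne]
    have e2 : finsetDeriv (f (nodeLabel root (Function.update dec k x) k.succ).1)
          (Finset.univ.filter fun i => g i = k.succ)
          (fun c => if c.val < k.val + 1 then
              EuclideanSpace.single (Function.update dec k x c).2 1
            else V c (nodeLabel root (Function.update dec k x) k.succ).1) y
          (nodeLabel root (Function.update dec k x) k.succ).2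
        = finsetDeriv (f x.1) (Finset.univ.filter fun c => g c = k.succ)
            (fun c => V c x.1) y x.2 := by
      have hl : nodeLabel root (Function.update dec k x) k.succ = x := by simp [nodeLabel]
      rw [hl, finsetDeriv_congr]
      intro c hc
      have hc : g c = k.succ := by simpa using hc
      have := hg c
      rw [hc, Fin.val_succ] at this
      rw [if_neg (by omega)]
    have e3 : finsetDeriv (f (nodeLabel root (Function.update dec k x) (g k)).1)
          (Finset.univ.filter fun i => g i = g k)
          (fun c => if c.val < k.val + 1 then
              EuclideanSpace.single (Function.update dec k x c).2 1
            else V c (nodeLabel root (Function.update dec k x) (g k)).1) y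
          (nodeLabel root (Function.update dec k x) (g k)).2
        = finsetDeriv (f P) (Finset.univ.filter fun i => g i = g k)
              (Function.update w k (EuclideanSpace.single x.2 1)) y
              (nodeLabel root dec (g k)).2 := by
      rw [nodeLabel_update _ _ _ _ (hg k), finsetDeriv_congr]
      intro c _
      by_cases hc : c = k
      · subst hc; simp
      · have := Fin.val_ne_of_ne hc
        simp only [Function.update_of_ne hc, hw]
        by_cases h : c.val < k.val
        · rw [if_pos h, if_pos (by omega)]
        · rw [if_neg h, if_neg (by omega)]
    have e4 : ∏ v ∈ (Finset.univ.filter fun v : Fin (N + 1) => v.val ≤ k.val).erase (g k),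
          finsetDeriv (f (nodeLabel root (Function.update dec k x) v).1)
          (Finset.univ.filter fun i => g i = v)
          (fun c => if c.val < k.val + 1 then
              EuclideanSpace.single (Function.update dec k x c).2 1
            else V c (nodeLabel root (Function.update dec k x) v).1) y
          (nodeLabel root (Function.update dec k x) v).2
        = ∏ v ∈ (Finset.univ.filter fun v : Fin (N + 1) => v.val ≤ k.val).erase (g k),
            finsetDeriv (f (nodeLabel root dec v).1) (Finset.univ.filter fun i => g i = v)
            (fun c => if c.val < k then EuclideanSpace.single (dec c).2 1
              else V c (nodeLabel root dec v).1) y (nodeLabel root dec v).2 := by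
      refine Finset.prod_congr rfl fun v hv => ?_
      rw [Finset.mem_erase, Finset.mem_filter] at hv
      rw [nodeLabel_update _ _ _ _ hv.2.2, finsetDeriv_congr]
      intro c hc
      have hc : c ≠ k := by
        rintro rfl
        exact hv.1 (Finset.mem_filter.1 hc).2.symm
      have := Fin.val_ne_of_ne hc
      rw [Function.update_of_ne hc]
      by_cases h : c.val < k.val
      · rw [if_pos h, if_pos (by omega)]
      · rw [if_neg h, if_neg (by omega)]
    rw [eliminationWeight, hf1, hf2, Finset.prod_insert (by simp), Finset.prod_insert (by simp),
      ← Finset.mul_prod_erase _ _ hmem, e1, e2, e3, e4, nodeLabel_update _ _ _ _ (hg k),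
      Function.update_self]
    ring
  have hVk : V k P = ∑ x : K × Fin d,
      (W k P x.1 * finsetDeriv (f x.1) (Finset.univ.filter fun c => g c = k.succ)
        (fun c => V c x.1) y x.2) • (EuclideanSpace.single x.2 (1 : ℝ) : Evec d) := by
    rw [hV, Fintype.sum_prod_type]
    refine Finset.sum_congr rfl fun Q _ => ?_
    conv_lhs => rw [Evec.eq_sum_single (finsetDeriv (f Q)
      (Finset.univ.filter fun c => g c = k.succ) (fun c => V c Q) y)]
    simp only [Finset.smul_sum, smul_smul]
  have hwk : Function.update w k (V k P) = w := by
    rw [Function.update_eq_self_iff]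
    simp [hw]
  have hfin := finsetDeriv_update_sum Finset.univ (f P)
    (C := Finset.univ.filter fun i => g i = g k) (k := k) (by simp) w
    (fun x : K × Fin d => W k P x.1 *
      finsetDeriv (f x.1) (Finset.univ.filter fun c => g c = k.succ) (fun c => V c x.1) y x.2)
    (fun x => (EuclideanSpace.single x.2 (1 : ℝ) : Evec d)) y
  rw [← hVk, hwk] at hfin
  simp only [hx]
  rw [← Finset.mul_sum, eliminationWeight, ← Finset.mul_prod_erase _ _ hmem, ← hP, ← hw, hfin]
  simp only [WithLp.ofLp_sum, Finset.sum_apply, PiLp.smul_apply, smul_eq_mul]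
  ring

/-- Summation over all decorations evaluates a tree from its leaves to its root. -/
theorem sum_decorations (hg : ∀ i, (g i).val ≤ i.val)
    (hV : ∀ i P, V i P = ∑ Q, W i P Q •
      finsetDeriv (f Q) (Finset.univ.filter fun c => g c = i.succ) (fun c => V c Q) y) :
    ∑ dec : Fin N → K × Fin d, (∏ i, W i (nodeLabel root dec (g i)).1 (dec i).1) *
        ∏ v, finsetDeriv (f (nodeLabel root dec v).1) (Finset.univ.filter fun i => g i = v)
          (basisDir fun i => (dec i).2) y (nodeLabel root dec v).2
      = finsetDeriv (f root.1) (Finset.univ.filter fun i => g i = 0)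
          (fun c => V c root.1) y root.2 := by
  classical
  have hstep : ∀ k ≤ N, ∑ dec ∈ growthDecorations root k,
        eliminationWeight f y W V root g k dec
      = ∑ dec ∈ growthDecorations root 0, eliminationWeight f y W V root g 0 dec := by
    intro k
    induction k with
    | zero => intro _; rfl
    | succ k ih =>
      intro hk
      have h1 := sum_growthDecorations_succ root (⟨k, hk⟩ : Fin N)
        (eliminationWeight f y W V root g (k + 1))
      refine h1.trans (Eq.trans ?_ (ih (by omega)))
      exact Finset.sum_congr rfl fun dec _ =>
        sum_eliminationWeight_update root hg hV ⟨k, hk⟩ dec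
  have hd0 : (growthDecorations root 0 : Finset (Fin N → K × Fin d)) = {fun _ => root} := by
    ext dec
    simp [growthDecorations, funext_iff]
  have hdN : (growthDecorations root N : Finset (Fin N → K × Fin d)) = Finset.univ := by
    ext dec
    simp only [growthDecorations, Finset.mem_filter, Finset.mem_univ, true_and, iff_true]
    intro i hi
    omega
  have hv0 : (Finset.univ.filter fun v : Fin (N + 1) => v.val ≤ 0) = {0} := by
    ext v
    rw [Finset.mem_filter_univ, Finset.mem_singleton, Fin.ext_iff, Fin.val_zero, Nat.le_zero]
  have hi : (Finset.univ.filter fun i : Fin N => i.val < N) = Finset.univ := by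
    ext i; simp
  have hv : (Finset.univ.filter fun v : Fin (N + 1) => v.val ≤ N) = Finset.univ := by
    ext v; simp; omega
  have h0 := hstep N le_rfl
  rw [hd0, hdN, Finset.sum_singleton] at h0
  refine Eq.trans ?_ (h0.trans ?_)
  · refine Finset.sum_congr rfl fun dec _ => ?_
    rw [eliminationWeight, hi, hv]
    simp only [Fin.is_lt, if_true]
    rfl
  · rw [eliminationWeight, hv0, Finset.prod_singleton, Finset.filter_false_of_mem (by simp),
      Finset.prod_empty, one_mul]
    simp only [Nat.not_lt_zero, if_false]
    rfl

end Elimination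

section Trees

theorem finsetDeriv_smul {E F : Type*} [NormedAddCommGroup E] [NormedSpace ℝ E]
    [NormedAddCommGroup F] [NormedSpace ℝ F] {N : ℕ} (f : E → F) (C : Finset (Fin N))
    (r : Fin N → ℝ) (w : Fin N → E) (x : E) :
    finsetDeriv f C (fun c => r c • w c) x = (∏ c ∈ C, r c) • finsetDeriv f C w x := by
  unfold finsetDeriv
  rw [ContinuousMultilinearMap.map_smul_univ]
  congr 1
  rw [← Finset.prod_coe_sort C r]
  exact (C.orderIsoOfFin rfl).toEquiv.prod_comp fun c : C => r c

/-- A stage of the method: an index pair together with a stage number. -/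
abbrev Stage (m s : ℕ) (M : Type) : Type := Option (Fin m × M) × Fin s

/-- The index pair of a stage. -/
def Stage.idx (Q : Stage m s M) : SIdx m M :=
  match Q.1 with
  | none => .det
  | some p => .sto p.1 p.2

/-- The colour of a stage. -/
def Stage.color (Q : Stage m s M) : Option (Fin m) := Q.1.map Prod.fst

/-- The coefficient coupling the stage `P` to the stage `Q`. -/
def SRK.coupling [Fintype M] (c : SRK m s M) (θ : Mbar M → ℝ) (P Q : Stage m s M) : ℝ :=
  c.Z θ P.idx Q.idx P.2 Q.2

theorem sum_stage [Fintype M] {α : Type*} [AddCommMonoid α] (X : SIdx m M → Fin s → α) :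
    ∑ Q : Stage m s M, X Q.idx Q.2
      = ∑ j, X .det j + ∑ j, ∑ r, ∑ μ, X (.sto r μ) j := by
  rw [Fintype.sum_prod_type_right, ← Finset.sum_add_distrib]
  refine Finset.sum_congr rfl fun j _ => ?_
  rw [Fintype.sum_option, Fintype.sum_prod_type]
  rfl

theorem sum_stage_color [Fintype M] (X : SIdx m M → Fin s → ℝ) (rc : Option (Fin m)) :
    ∑ Q : Stage m s M, (if Q.color = rc then X Q.idx Q.2 else 0)
      = match rc with
        | none => ∑ j, X .det j
        | some r => ∑ μ, ∑ j, X (.sto r μ) j := by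
  rw [Fintype.sum_prod_type, Fintype.sum_option, Fintype.sum_prod_type]
  cases rc with
  | none => simp [Stage.color, Stage.idx]
  | some r =>
    simp only [Stage.color, Stage.idx, Option.map_none, Option.map_some, reduceCtorEq, if_false,
      Finset.sum_const_zero, zero_add, Option.some.injEq]
    rw [Finset.sum_eq_single r]
    · simp
    · intro r' _ h
      simp [h]
    · simp

variable {N : ℕ}

theorem STree.lt_of_mem_child (t : STree N m) {i c : Fin N} (h : c ∈ t.child i.succ) :
    i < c := by
  have h1 := (Finset.mem_filter.1 h).2
  have h2 := t.mono c
  rw [h1, Fin.val_succ] at h2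
  exact h2

/-- A recursion over the sons of a node stabilises as soon as the fuel reaches the height. -/
theorem STree.fuel_independent (t : STree N m) {X : Type*} (F : ℕ → Fin N → X)
    (step : ∀ p q i, (∀ c ∈ t.child i.succ, F p c = F q c) → F (p + 1) i = F (q + 1) i)
    (p : ℕ) : ∀ q i, N ≤ p + i.val → N ≤ q + i.val → F p i = F q i := by
  induction p with
  | zero =>
    intro q i hp
    omega
  | succ p ih =>
    intro q i hp hq
    cases q with
    | zero => omega
    | succ q =>
      refine step p q i fun c hc => ih q c ?_ ?_ <;>
      · have := t.lt_of_mem_child hc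
        simp only [Fin.lt_def] at this
        omega

theorem STree.size_eq (t : STree N m) (i : Fin N) :
    t.size i = 1 + ∑ c ∈ t.child i.succ, t.size c := by
  refine (t.fuel_independent (sizeAux t) (fun p q i h => ?_) N (N + 1) i (by omega)
    (by omega)).trans rfl
  simp only [sizeAux]
  rw [Finset.sum_congr rfl h]

theorem STree.densNode_eq (t : STree N m) (i : Fin N) :
    t.densNode i = t.size i * ∏ c ∈ t.child i.succ, t.densNode c := by
  refine (t.fuel_independent (densAux t) (fun p q i h => ?_) N (N + 1) i (by omega)
    (by omega)).trans rfl
  simp only [densAux]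
  rw [Finset.prod_congr rfl h]

theorem elemF_eq (a : Evec d → Evec d) (b : Fin m → Evec d → Evec d) (t : STree N m)
    (i : Fin N) (x : Evec d) :
    elemF a b t i x
      = finsetDeriv (nodeFun a b (t.color i)) (t.child i.succ) (fun c => elemF a b t c x) x := by
  refine (t.fuel_independent (fun p i => elemFAux a b t p i x) (fun p q i h => ?_) N (N + 1) i
    (by omega) (by omega)).trans rfl
  simp only [elemFAux]
  congr 1
  ext1 r
  exact h _ ((t.child i.succ).orderIsoOfFin rfl r).2

theorem PsiN_eq [Fintype M] (c : SRK m s M) (θ : Mbar M → ℝ) (t : STree N m) (i : Fin N)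
    (P : Stage m s M) :
    PsiN c θ t i P.idx P.2 = ∑ Q : Stage m s M, if Q.color = t.color i then
      c.coupling θ P Q * ∏ cc ∈ t.child i.succ, PsiN c θ t cc Q.idx Q.2 else 0 := by
  have h := congrFun (congrFun (t.fuel_independent (PsiAux c θ t) (fun p q i h => by
    simp only [PsiAux]
    ext1 P; ext1 Q
    cases t.color i <;>
    · simp only
      simp_rw [Finset.prod_congr rfl fun cc hc => congrFun (congrFun (h cc hc) _) _])
    N (N + 1) i (by omega) (by omega)) P.idx) P.2
  exact h.trans (sum_stage_color (fun p j => c.Z θ P.idx p P.2 j *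
    ∏ cc ∈ t.child i.succ, PsiN c θ t cc p j) _).symm

theorem zPhi_eq [Fintype M] (c : SRK m s M) (θ : Mbar M → ℝ) (t : STree N m)
    (rc : Option (Fin m)) :
    zPhi c θ rc t = ∑ Q : Stage m s M, if Q.color = rc then
      c.z θ Q.idx Q.2 * ∏ cc ∈ t.child 0, PsiN c θ t cc Q.idx Q.2 else 0 := by
  rw [sum_stage_color (fun p j => c.z θ p j * ∏ cc ∈ t.child 0, PsiN c θ t cc p j)]
  rfl

/-- Subtree sizes of a father map that respects the labelling. -/
def fatherSize (g : Fin N → Fin (N + 1)) (i : Fin N) : ℕ :=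
  if h : ∀ i, (g i).val ≤ i.val then (STree.mk (m := 0) g (fun _ => none) h).size i else 0

theorem fatherSize_eq (g : Fin N → Fin (N + 1)) (hg : ∀ i, (g i).val ≤ i.val) (i : Fin N) :
    fatherSize g i = 1 + ∑ c with g c = i.succ, fatherSize g c := by
  simp only [fatherSize, dif_pos hg]
  exact STree.size_eq _ i

theorem STree.fatherSize_father (t : STree N m) (i : Fin N) :
    fatherSize t.father i = t.size i := by
  rw [fatherSize, dif_pos t.mono]
  have : ∀ p i, sizeAux (STree.mk (m := 0) t.father (fun _ => none) t.mono) p i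
      = sizeAux t p i := by
    intro p
    induction p with
    | zero => intro i; rfl
    | succ p ih =>
      intro i
      simp only [sizeAux, ih]
      rfl
  exact this N i

theorem sum_STree {α : Type*} [AddCommMonoid α]
    (X : (Fin N → Fin (N + 1)) → (Fin N → Option (Fin m)) → α) :
    ∑ t : STree N m, X t.father t.color
      = ∑ g with ∀ i : Fin N, (g i).val ≤ i.val, ∑ col, X g col := by
  rw [Finset.sum_filter, ← (STree.equivSubtype N m).symm.sum_comp]
  have h1 := Finset.sum_subtype (Finset.univ.filter
    fun p : (Fin N → Fin (N+1)) × (Fin N → Option (Fin m)) => ∀ i : Fin N, (p.1 i).val ≤ i.val)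
    (p := fun p => ∀ i : Fin N, (p.1 i).val ≤ i.val) (F := inferInstance) (by simp)
    (fun p => X p.1 p.2)
  refine Eq.trans (Eq.trans ?_ h1.symm) ?_
  · rfl
  · rw [Finset.sum_filter, Fintype.sum_prod_type]
    refine Finset.sum_congr rfl fun g _ => ?_
    by_cases h : ∀ i, (g i).val ≤ i.val <;> simp [h]

variable [Fintype M] (c : SRK m s M) (θ : Mbar M → ℝ) (a : Evec d → Evec d)
  (b : Fin m → Evec d → Evec d) (y : Evec d)

/-- The weighted elementary differential of the subtree at the node `i`, as seen from a father
that is evaluated at the stage `P`. -/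
def subtreeValue (t : STree N m) (i : Fin N) (P : Stage m s M) : Evec d :=
  ((t.densNode i : ℝ) * PsiN c θ t i P.idx P.2) • elemF a b t i y

theorem finsetDeriv_subtreeValue (t : STree N m) (f : Evec d → Evec d) (C : Finset (Fin N))
    (Q : Stage m s M) :
    finsetDeriv f C (fun i => subtreeValue c θ a b y t i Q) y
      = ((∏ i ∈ C, (t.densNode i : ℝ)) * ∏ i ∈ C, PsiN c θ t i Q.idx Q.2) •
        finsetDeriv f C (fun i => elemF a b t i y) y := by
  unfold subtreeValue
  rw [finsetDeriv_smul, Finset.prod_mul_distrib]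

theorem subtreeValue_eq (t : STree N m) (i : Fin N) (P : Stage m s M) :
    subtreeValue c θ a b y t i P = ∑ Q : Stage m s M,
      ((fatherSize t.father i : ℝ) * if Q.color = t.color i then c.coupling θ P Q else 0) •
        finsetDeriv (nodeFun a b Q.color) (Finset.univ.filter fun c => t.father c = i.succ)
          (fun i => subtreeValue c θ a b y t i Q) y := by
  rw [subtreeValue, t.densNode_eq, PsiN_eq, elemF_eq, Finset.mul_sum, Finset.sum_smul]
  refine Finset.sum_congr rfl fun Q _ => ?_
  rw [finsetDeriv_subtreeValue, t.fatherSize_father, smul_smul]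
  split_ifs with h
  · rw [h]
    congr 1
    push_cast
    simp only [STree.child]
    ring
  · simp

/-- Summing over all decorations amounts to summing over the colours. -/
theorem sum_decorations_eq_sum_STree (root : Stage m s M × Fin d) :
    ∑ g with ∀ i : Fin N, (g i).val ≤ i.val, ∑ dec : Fin N → Stage m s M × Fin d,
        (∏ i, (fatherSize g i : ℝ) *
          c.coupling θ (nodeLabel root dec (g i)).1 (dec i).1) *
        ∏ v, finsetDeriv (nodeFun a b (nodeLabel root dec v).1.color)
          (Finset.univ.filter fun i => g i = v) (basisDir fun i => (dec i).2) y
          (nodeLabel root dec v).2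
      = ∑ t : STree N m, finsetDeriv (nodeFun a b root.1.color) (t.child 0)
          (fun i => subtreeValue c θ a b y t i root.1) y root.2 := by
  have hcol : ∀ (g : Fin N → Fin (N + 1)) (dec : Fin N → Stage m s M × Fin d),
      ∏ i, (fatherSize g i : ℝ) * c.coupling θ (nodeLabel root dec (g i)).1 (dec i).1
        = ∑ col : Fin N → Option (Fin m), ∏ i, (fatherSize g i : ℝ) *
          if (dec i).1.color = col i then
            c.coupling θ (nodeLabel root dec (g i)).1 (dec i).1 else 0 := by
    intro g dec
    have h := Finset.prod_univ_sum (fun _ : Fin N => (Finset.univ : Finset (Option (Fin m))))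
      (fun i col => (fatherSize g i : ℝ) * if (dec i).1.color = col then
            c.coupling θ (nodeLabel root dec (g i)).1 (dec i).1 else 0)
    rw [Fintype.piFinset_univ] at h
    rw [← h]
    refine Finset.prod_congr rfl fun i _ => ?_
    rw [← Finset.mul_sum, Finset.sum_ite_eq, if_pos (Finset.mem_univ _)]
  simp only [hcol, Finset.sum_mul]
  rw [Finset.sum_congr rfl fun g _ => Finset.sum_comm]
  rw [← sum_STree (fun g col => ∑ dec : Fin N → Stage m s M × Fin d,
    (∏ i, (fatherSize g i : ℝ) * if (dec i).1.color = col i then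
      c.coupling θ (nodeLabel root dec (g i)).1 (dec i).1 else 0) *
    ∏ v, finsetDeriv (nodeFun a b (nodeLabel root dec v).1.color)
      (Finset.univ.filter fun i => g i = v) (basisDir fun i => (dec i).2) y
      (nodeLabel root dec v).2)]
  refine Finset.sum_congr rfl fun t _ => ?_
  exact sum_decorations (f := fun Q : Stage m s M => nodeFun a b Q.color)
    (W := fun i P Q => (fatherSize t.father i : ℝ) *
      if Q.color = t.color i then c.coupling θ P Q else 0)
    (V := subtreeValue c θ a b y t) root t.mono (subtreeValue_eq c θ a b y t)

theorem sum_stage_finsetDeriv (t : STree N m) (rc : Option (Fin m)) (J : Fin d) :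
    ∑ Q : Stage m s M, (if Q.color = rc then c.z θ Q.idx Q.2 *
        finsetDeriv (nodeFun a b Q.color) (t.child 0)
          (fun i => subtreeValue c θ a b y t i Q) y J else 0)
      = (∏ i ∈ t.child 0, (t.densNode i : ℝ)) * zPhi c θ rc t * elemFRootV a b rc t y J := by
  rw [zPhi_eq, Finset.mul_sum, Finset.sum_mul]
  refine Finset.sum_congr rfl fun Q _ => ?_
  split_ifs with h
  · have hF : elemFRootV a b rc t y
        = finsetDeriv (nodeFun a b rc) (t.child 0) (fun i => elemF a b t i y) y := rfl
    rw [finsetDeriv_subtreeValue, h, PiLp.smul_apply, smul_eq_mul, hF]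
    ring
  · simp

end Trees

section Expansion

variable {n : ℕ} {a : Evec d → Evec d} {b : Fin m → Evec d → Evec d} {y : Evec d}

theorem nodeFun_color_stage (Q : Stage m s M) :
    nodeFun a b Q.color = match Q.idx with
      | .det => a
      | .sto r _ => b r := by
  rcases Q with ⟨_ | ⟨r, μ⟩, j⟩ <;> rfl

variable {H : ℝ → SIdx m M → Fin s → Evec d}
  (ha : ContDiff ℝ (n + 1 : ℕ) a) (hb : ∀ k, ContDiff ℝ (n + 1 : ℕ) (b k))
  (hH : ∀ p i, ContDiffAt ℝ (n + 1 : ℕ) (fun u => H u p i) 0)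

include ha hb in
theorem contDiff_nodeFun (k : Option (Fin m)) : ContDiff ℝ (n + 1 : ℕ) (nodeFun a b k) := by
  cases k with
  | none => exact ha
  | some k => exact hb k

include ha hb hH in
theorem contDiffAt_nodeFun_stage (Q : Stage m s M) (i : Fin d) :
    ContDiffAt ℝ (n + 1 : ℕ) (fun u => nodeFun a b Q.color (H u Q.idx Q.2) i) 0 :=
  (EuclideanSpace.proj (𝕜 := ℝ) i).contDiff.contDiffAt.comp 0
    ((contDiff_nodeFun ha hb Q.color).contDiffAt.comp 0 (hH Q.idx Q.2))

variable [Fintype M] {c : SRK m s M} {θ : Mbar M → ℝ}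

theorem SRK.Z_smul (c : SRK m s M) (θ : Mbar M → ℝ) (u : ℝ) (p q : SIdx m M) (i j : Fin s) :
    c.Z (u • θ) p q i j = u * c.Z θ p q i j := by
  cases q with
  | det => simp [SRK.Z]; ring
  | sto r μ =>
    simp only [SRK.Z, Pi.smul_apply, smul_eq_mul, Finset.mul_sum]
    exact Finset.sum_congr rfl fun _ _ => by ring

theorem SRK.z_smul (c : SRK m s M) (θ : Mbar M → ℝ) (u : ℝ) (p : SIdx m M) (i : Fin s) :
    c.z (u • θ) p i = u * c.z θ p i := by
  cases p with
  | det => simp [SRK.z]; ring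
  | sto r μ =>
    simp only [SRK.z, Pi.smul_apply, smul_eq_mul, Finset.mul_sum]
    exact Finset.sum_congr rfl fun _ _ => by ring

theorem StageEq.apply_eq {u : ℝ} {H : SIdx m M → Fin s → Evec d}
    (h : StageEq c a b y (u • θ) H) (P : Stage m s M) (i : Fin d) :
    H P.idx P.2 i = y i + u * ∑ Q : Stage m s M, c.coupling θ P Q *
      nodeFun a b Q.color (H Q.idx Q.2) i := by
  have hs := sum_stage (m := m) (s := s) (M := M) (fun q j => c.Z θ P.idx q P.2 j *
    (match q with
      | .det => a
      | .sto r _ => b r) (H q j) i)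
  simp only [nodeFun_color_stage]
  refine Eq.trans ?_ (congrArg (fun t => y i + u * t) hs.symm)
  rw [h P.idx P.2]
  simp only [SRK.Z_smul, PiLp.add_apply, WithLp.ofLp_sum, Finset.sum_apply, PiLp.smul_apply,
    smul_eq_mul, Finset.mul_sum, mul_add, mul_assoc, add_assoc]

theorem oneStep_apply_eq (u : ℝ) (H : SIdx m M → Fin s → Evec d) (i : Fin d) :
    oneStep c a b y (u • θ) H i = y i + u * ∑ Q : Stage m s M, c.z θ Q.idx Q.2 *
      nodeFun a b Q.color (H Q.idx Q.2) i := by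
  have hs := sum_stage (m := m) (s := s) (M := M) (fun q j => c.z θ q j *
    (match q with
      | .det => a
      | .sto r _ => b r) (H q j) i)
  simp only [nodeFun_color_stage]
  refine Eq.trans ?_ (congrArg (fun t => y i + u * t) hs.symm)
  rw [oneStep]
  simp only [SRK.z_smul, PiLp.add_apply, WithLp.ofLp_sum, Finset.sum_apply, PiLp.smul_apply,
    smul_eq_mul, Finset.mul_sum, mul_add, mul_assoc, add_assoc]

variable (hstage : ∀ᶠ u in nhds (0 : ℝ), StageEq c a b y (u • θ) (H u))

include ha hb hH in
theorem iteratedDeriv_sum_nodeFun_stage (coeff : Stage m s M → ℝ) (i : Fin d) {q : ℕ}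
    (hq : q ≤ n) :
    iteratedDeriv (q + 1) (fun u => y i + u * ∑ Q : Stage m s M, coeff Q *
        nodeFun a b Q.color (H u Q.idx Q.2) i) 0
      = (q + 1 : ℝ) * ∑ Q : Stage m s M, coeff Q *
        iteratedDeriv q (fun u => nodeFun a b Q.color (H u Q.idx Q.2) i) 0 := by
  have hsm : ∀ Q : Stage m s M, ContDiffAt ℝ (q + 1 : ℕ)
      (fun u => coeff Q * nodeFun a b Q.color (H u Q.idx Q.2) i) 0 := fun Q =>
    contDiffAt_const.mul ((contDiffAt_nodeFun_stage ha hb hH Q i).of_le (by norm_cast; omega))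
  rw [iteratedDeriv_succ_const_add_id_mul _ (ContDiffAt.sum fun Q _ => hsm Q),
    iteratedDeriv_fun_sum fun Q _ => (hsm Q).of_le (by norm_cast; omega)]
  simp only [iteratedDeriv_const_mul_field]

include ha hb hH hstage in
/-- The derivatives of the stage functions along a line are sums over trees. -/
theorem iteratedDeriv_nodeFun_stage {N : ℕ} (hN : N ≤ n) (P : Stage m s M) (j : Fin d) :
    iteratedDeriv N (fun u => nodeFun a b P.color (H u P.idx P.2) j) 0
      = ∑ t : STree N m, finsetDeriv (nodeFun a b P.color) (t.child 0)
          (fun i => subtreeValue c θ a b y t i P) y j := by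
  have h0 : ∀ P : Stage m s M, H 0 P.idx P.2 = y := by
    intro P
    ext i
    rw [hstage.self_of_nhds.apply_eq P i]
    simp
  have hgrowth := sum_growthWeight (N := N)
    (A := fun (P : Stage m s M) (j : Fin d) C w r => iteratedDeriv r (fun u =>
      finsetDeriv (nodeFun a b P.color) C (basisDir w) (H u P.idx P.2) j) 0)
    (W := c.coupling θ) (sz := fatherSize)
    (fun P j C w w' r h => by
      rw [finsetDeriv_congr (nodeFun a b P.color) C (w := basisDir w) (w' := basisDir w')
        fun c hc => by rw [basisDir, basisDir, h c hc]])
    fatherSize_eq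
    (fun P j C k w r hk hr => by
      rw [iteratedDeriv_succ_finsetDeriv_comp hk
        ((contDiff_nodeFun ha hb P.color).of_le (by norm_cast; omega))
        ((hH P.idx P.2).of_le (by norm_cast; omega))]
      refine Finset.sum_congr rfl fun q hq => ?_
      have hq : q ≤ n := by
        have := Finset.mem_range.1 hq
        omega
      congr 1
      refine Finset.sum_congr rfl fun i _ => ?_
      congr 1
      have hev : (fun u => H u P.idx P.2 i) =ᶠ[nhds 0] fun u =>
          y i + u * ∑ Q : Stage m s M, c.coupling θ P Q *
            nodeFun a b Q.color (H u Q.idx Q.2) i := by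
        filter_upwards [hstage] with u hu using hu.apply_eq P i
      rw [hev.iteratedDeriv_eq, iteratedDeriv_sum_nodeFun_stage ha hb hH _ i hq]
      simp only [finsetDeriv_empty])
    (P, j)
  simp only [finsetDeriv_empty, iteratedDeriv_zero, h0] at hgrowth
  rw [hgrowth]
  exact sum_decorations_eq_sum_STree c θ a b y (P, j)

include ha hb hH hstage in
/-- The derivatives of the one-step value along a line are sums over trees. -/
theorem iteratedDeriv_oneStep {N : ℕ} (hN : N ≤ n) (j : Fin d) :
    iteratedDeriv (N + 1) (fun u => oneStep c a b y (u • θ) (H u) j) 0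
      = ∑ rc : Option (Fin m), ∑ t : STree N m,
          (t.densR : ℝ) * zPhi c θ rc t * elemFRootV a b rc t y j := by
  simp only [oneStep_apply_eq]
  rw [iteratedDeriv_sum_nodeFun_stage ha hb hH _ j hN]
  have hcol : ∀ (Q : Stage m s M) (x : ℝ),
      x = ∑ rc : Option (Fin m), if Q.color = rc then x else 0 := by
    intro Q x
    rw [Finset.sum_ite_eq, if_pos (Finset.mem_univ _)]
  rw [Finset.sum_congr rfl fun Q _ => hcol Q _, Finset.sum_comm, Finset.mul_sum]
  refine Finset.sum_congr rfl fun rc _ => ?_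
  have hrc : ∑ Q : Stage m s M, (if Q.color = rc then c.z θ Q.idx Q.2 *
      iteratedDeriv N (fun u => nodeFun a b Q.color (H u Q.idx Q.2) j) 0 else 0)
      = ∑ t : STree N m, ∑ Q : Stage m s M, (if Q.color = rc then c.z θ Q.idx Q.2 *
        finsetDeriv (nodeFun a b Q.color) (t.child 0)
          (fun i => subtreeValue c θ a b y t i Q) y j else 0) := by
    rw [Finset.sum_comm]
    refine Finset.sum_congr rfl fun Q _ => ?_
    rw [iteratedDeriv_nodeFun_stage ha hb hH hstage hN Q j]
    split_ifs
    · rw [Finset.mul_sum]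
    · simp
  rw [hrc, Finset.mul_sum]
  refine Finset.sum_congr rfl fun t _ => ?_
  rw [sum_stage_finsetDeriv, STree.densR]
  push_cast
  ring

end Expansion

section Taylor

theorem exists_taylor_lagrange_unit {f : ℝ → ℝ} {V : Set ℝ} {n : ℕ} (hV : IsOpen V)
    (hsub : Set.Icc 0 1 ⊆ V) (hf : ContDiffOn ℝ (n + 1 : ℕ) f V) :
    ∃ ξ ∈ Set.Ioo (0 : ℝ) 1, f 1 = f 0
      + ∑ l ∈ Finset.range n, iteratedDeriv (l + 1) f 0 / ((l + 1).factorial : ℝ)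
      + 1 / ((n + 1).factorial : ℝ) * iteratedDeriv (n + 1) f ξ := by
  obtain ⟨ξ, hξ, h⟩ := taylor_mean_remainder_lagrange_iteratedDeriv (f := f) (n := n)
    (zero_ne_one (α := ℝ)) (by
      rw [Set.uIcc_of_le zero_le_one]
      exact (hf.mono hsub).of_le (by push_cast; exact le_rfl))
  rw [Set.uIoo_of_le zero_le_one] at hξ
  refine ⟨ξ, hξ, ?_⟩
  have hT : taylorWithinEval f n (Set.uIcc 0 1) 0 1
      = f 0 + ∑ l ∈ Finset.range n, iteratedDeriv (l + 1) f 0 / ((l + 1).factorial : ℝ) := by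
    rw [taylor_within_apply, Finset.sum_range_succ', add_comm]
    congr 1
    · simp
    · refine Finset.sum_congr rfl fun l hl => ?_
      have hl := Finset.mem_range.1 hl
      rw [Set.uIcc_of_le zero_le_one, iteratedDerivWithin_eq_iteratedDeriv
        (uniqueDiffOn_Icc_zero_one) ((hf.contDiffAt (hV.mem_nhds (hsub (by simp)))).of_le
          (by norm_cast; omega)) (by simp)]
      simp [div_eq_inv_mul]
  rw [hT, sub_eq_iff_eq_add'] at h
  rw [h]
  simp [div_eq_inv_mul]

theorem iteratedDeriv_comp_line {ι : Type} [Fintype ι] [DecidableEq ι] {g : (ι → ℝ) → ℝ}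
    {U : Set (ι → ℝ)} (hU : IsOpen U) {k : ℕ} (hg : ContDiffOn ℝ k g U) (θ : ι → ℝ) {ξ : ℝ}
    (hξ : ξ • θ ∈ U) :
    iteratedDeriv k (fun u : ℝ => g (u • θ)) ξ
      = ∑ νs : Fin k → ι, (∏ p, θ (νs p)) *
          iteratedFDeriv ℝ k g (ξ • θ) (fun p => Pi.single (νs p) 1) := by
  set L : ℝ →L[ℝ] (ι → ℝ) := (ContinuousLinearMap.id ℝ ℝ).smulRight θ with hL
  have hL1 : ∀ u, L u = u • θ := fun u => by simp [hL]
  have hopen : IsOpen (L ⁻¹' U) := hU.preimage L.continuous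
  have hmem : L ξ ∈ U := by rwa [hL1]
  have hcomp := L.iteratedFDerivWithin_comp_right hg hU.uniqueDiffOn hopen.uniqueDiffOn hmem
    (i := k) le_rfl
  rw [iteratedFDerivWithin_of_isOpen k hopen hmem, iteratedFDerivWithin_of_isOpen k hU hmem]
    at hcomp
  have hfun : (fun u : ℝ => g (u • θ)) = g ∘ L := by
    ext u
    simp [hL1]
  have hθ : θ = ∑ i, θ i • (Pi.single i (1 : ℝ) : ι → ℝ) := by
    ext j
    simp [Finset.sum_apply, Pi.single_apply]
  rw [iteratedDeriv_eq_iteratedFDeriv, hfun, hcomp]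
  simp only [ContinuousMultilinearMap.compContinuousLinearMap_apply, hL1, one_smul]
  conv_lhs =>
    enter [2, p]
    rw [hθ]
  rw [ContinuousMultilinearMap.map_sum]
  simp only [ContinuousMultilinearMap.map_smul_univ, smul_eq_mul]

end Taylor

/-- Rooted-tree representation of the SRK one-step value with Lagrange
Taylor remainder. -/
theorem srk_onestep_tree_representation
    (d m s n : ℕ) (M : Type) [Fintype M] [DecidableEq M]
    (c : SRK m s M)
    (a : Evec d → Evec d) (b : Fin m → Evec d → Evec d)
    (ha : ContDiff ℝ (n+1) a) (hb : ∀ k, ContDiff ℝ (n+1) (b k))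
    (y0 : Evec d) (θv : Mbar M → ℝ)
    (H : (Mbar M → ℝ) → SIdx m M → Fin s → Evec d)
    (U : Set (Mbar M → ℝ)) (hU : IsOpen U) (hseg : segment ℝ 0 θv ⊆ U)
    (hsm : ∀ (p : SIdx m M) (i : Fin s), ContDiffOn ℝ (n+1) (fun θ => H θ p i) U)
    (hstage : ∀ θ ∈ U, StageEq c a b y0 θ (H θ)) :
    ∀ J : Fin d, ∃ ξ ∈ Set.Ioo (0:ℝ) 1,
      oneStep c a b y0 θv (H θv) J =
        y0 J
        + (∑ l ∈ Finset.range n, ∑ rc : Option (Fin m), ∑ t : STree l m,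
            (t.densR : ℝ) * zPhi c θv rc t * elemFRootV a b rc t y0 J
              / (Nat.factorial (l+1) : ℝ))
        + (1 / (Nat.factorial (n+1) : ℝ)) *
            ∑ νs : Fin (n+1) → Mbar M, (∏ p, θv (νs p)) *
              iteratedFDeriv ℝ (n+1) (fun θ => oneStep c a b y0 θ (H θ) J) (ξ • θv)
                (fun p => Pi.single (νs p) 1) := by
  intro J
  have ha' : ContDiff ℝ (n + 1 : ℕ) a := by exact_mod_cast ha
  have hb' : ∀ k, ContDiff ℝ (n + 1 : ℕ) (b k) := by exact_mod_cast hb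
  have hsm' : ∀ p i, ContDiffOn ℝ (n + 1 : ℕ) (fun θ => H θ p i) U := by exact_mod_cast hsm
  have hz : ∀ p i, ContDiff ℝ (n + 1 : ℕ) fun θ : Mbar M → ℝ => c.z θ p i := by
    intro p i
    cases p with
    | det => exact contDiff_const.mul (contDiff_apply ℝ ℝ _)
    | sto r μ => exact ContDiff.sum fun ι _ => contDiff_const.mul (contDiff_apply ℝ ℝ _)
  have hY : ContDiffOn ℝ (n + 1 : ℕ) (fun θ => oneStep c a b y0 θ (H θ)) U :=
    (contDiffOn_const.add (ContDiffOn.sum fun i _ =>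
      (hz .det i).contDiffOn.smul (ha'.comp_contDiffOn (hsm' _ _)))).add
      (ContDiffOn.sum fun i _ => ContDiffOn.sum fun k _ => ContDiffOn.sum fun ν _ =>
        (hz (.sto k ν) i).contDiffOn.smul ((hb' k).comp_contDiffOn (hsm' _ _)))
  have hYJ : ContDiffOn ℝ (n + 1 : ℕ) (fun θ => oneStep c a b y0 θ (H θ) J) U :=
    (EuclideanSpace.proj (𝕜 := ℝ) J).contDiff.comp_contDiffOn hY
  have hline : ContDiff ℝ (n + 1 : ℕ) fun u : ℝ => u • θv := contDiff_id.smul contDiff_const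
  have hV : IsOpen ((fun u : ℝ => u • θv) ⁻¹' U) := hU.preimage hline.continuous
  have hsub : Set.Icc (0 : ℝ) 1 ⊆ (fun u : ℝ => u • θv) ⁻¹' U := by
    intro u hu
    exact hseg ⟨1 - u, u, by linarith [hu.2], hu.1, by ring, by simp⟩
  have h0 : (fun u : ℝ => u • θv) ⁻¹' U ∈ nhds (0 : ℝ) := hV.mem_nhds (hsub (by simp))
  obtain ⟨ξ, hξ, h⟩ := exists_taylor_lagrange_unit hV hsub
    (hYJ.comp hline.contDiffOn fun _ hu => hu)
  refine ⟨ξ, hξ, ?_⟩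
  have hrem := iteratedDeriv_comp_line hU hYJ θv (hsub ⟨hξ.1.le, hξ.2.le⟩)
  have hder : ∀ l ∈ Finset.range n,
      iteratedDeriv (l + 1) (fun u : ℝ => oneStep c a b y0 (u • θv) (H (u • θv)) J) 0
        = ∑ rc : Option (Fin m), ∑ t : STree l m,
          (t.densR : ℝ) * zPhi c θv rc t * elemFRootV a b rc t y0 J := by
    intro l hl
    refine iteratedDeriv_oneStep ha' hb' (H := fun u => H (u • θv)) (fun p i => ?_) ?_
      (Finset.mem_range.1 hl).le J
    · exact ((hsm' p i).comp hline.contDiffOn fun _ hu => hu).contDiffAt h0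
    · filter_upwards [h0] with u hu using hstage _ hu
  have hstart : oneStep c a b y0 ((0 : ℝ) • θv) (H ((0 : ℝ) • θv)) J = y0 J := by
    rw [oneStep_apply_eq]
    simp
  simp only [Function.comp_def, one_smul] at h
  rw [h, hstart, hrem, Finset.sum_congr rfl fun l hl => congrArg (· / _) (hder l hl)]
  simp only [Finset.sum_div]

end SRKPaper
end
end

section
/- Generalized Leibniz formula for the SRK stage values: Let q∈ℕ, let a, b^1,…,b^m be q-times continuously differentiable, and assume the stage values H_i^{(k,ν)}(t) are q-times continuously differentiable functions of θ∈ℝ^{κ+1} satisfying the stage equations identically. Then for every component J, every i∈{1,…,s}, k∈{0,…,m}, ν∈M̄, the following identity of functions of θ holds: Σ_{ν_1,…,ν_q∈M̄} ∂^q H_i^{(k,ν)}(t)^J/(∂θ_{ν_1}⋯∂θ_{ν_q}) = q·Σ_{j=1}^s A_{ij}^{(k,ν),(0,0)} Σ_{ν_1,…,ν_{q−1}∈M̄} ∂^{q−1} a(H_j^{(0,0)}(t))^J/(∂θ_{ν_1}⋯∂θ_{ν_{q−1}}) + q·Σ_{j=1}^s Σ_{r=1}^m Σ_{μ,ν_q∈M}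 B_{ij}^{(ν_q)(k,ν),(r,μ)} Σ_{ν_1,…,ν_{q−1}∈M̄} ∂^{q−1} b^r(H_j^{(r,μ)}(t))^J/(∂θ_{ν_1}⋯∂θ_{ν_{q−1}}) + Σ_{j=1}^s A_{ij}^{(k,ν),(0,0)}·θ_0 · Σ_{ν_1,…,ν_q∈M̄} ∂^q a(H_j^{(0,0)}(t))^J/(∂θ_{ν_1}⋯∂θ_{ν_q}) + Σ_{j=1}^s Σ_{r=1}^m Σ_{μ,ι∈M} B_{ij}^{(ι)(k,ν),(r,μ)}·θ_ι · Σ_{ν_1,…,ν_q∈M̄} ∂^q b^r(H_j^{(r,μ)}(t))^J/(∂θ_{ν_1}⋯∂θ_{ν_q}). -/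
open scoped BigOperators
open Finset MeasureTheory ProbabilityTheory

noncomputable section

namespace SRKPaper

/-- The sum of all `q`-th order partial derivatives is the `q`-fold derivative in the
direction `(1,…,1)`. -/
lemma derSum_eq_iteratedFDeriv {ι : Type} [Fintype ι] [DecidableEq ι] {F : Type}
    [NormedAddCommGroup F] [NormedSpace ℝ F] (q : ℕ) (g : (ι → ℝ) → F) (θ : ι → ℝ) :
    DerSum q g θ = iteratedFDeriv ℝ q g θ fun _ => 1 := by
  have h : (1 : ι → ℝ) = ∑ ν : ι, Pi.single ν 1 := (Finset.univ_sum_single 1).symm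
  rw [h, DerSum]
  exact ((iteratedFDeriv ℝ q g θ).map_sum (fun _ ν => Pi.single ν 1)).symm

/-- The `(n+1)`-fold derivative in direction `v` is the derivative along `v` of the `n`-fold one. -/
lemma hasDerivAt_iteratedFDeriv_diagonal {E F : Type*}
    [NormedAddCommGroup E] [NormedSpace ℝ E]
    [NormedAddCommGroup F] [NormedSpace ℝ F] {n : ℕ} {g : E → F} (hg : ContDiff ℝ (n + 1 : ℕ) g)
    (x v : E) :
    HasDerivAt (fun t : ℝ => iteratedFDeriv ℝ n g (x + t • v) fun _ => v)
      (iteratedFDeriv ℝ (n + 1) g x fun _ => v) 0 := by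
  have hd : DifferentiableAt ℝ (iteratedFDeriv ℝ n g) (x + (0 : ℝ) • v) :=
    (hg.differentiable_iteratedFDeriv (by exact_mod_cast Nat.lt_succ_self n)) _
  have hline : HasDerivAt (fun t : ℝ => x + t • v) v 0 := by
    simpa using ((hasDerivAt_id (0 : ℝ)).smul_const v).const_add x
  have h := hd.hasFDerivAt.comp_hasDerivAt (0 : ℝ) hline
  have h' := (ContinuousMultilinearMap.apply ℝ (fun _ : Fin n => E) F
    (fun _ => v)).hasFDerivAt.comp_hasDerivAt (0 : ℝ) h
  simpa [iteratedFDeriv_succ_apply_left, Fin.tail_def, Function.comp_def] using h'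

/-- The Leibniz formula for the product with a linear form: only two terms survive. -/
lemma iteratedFDeriv_linear_mul_diagonal {E : Type*} [NormedAddCommGroup E] [NormedSpace ℝ E]
    (L : E →L[ℝ] ℝ) {n : ℕ} {g : E → ℝ} (hg : ContDiff ℝ n g) (x v : E) :
    iteratedFDeriv ℝ n (fun y => L y * g y) x (fun _ => v)
      = n * L v * iteratedFDeriv ℝ (n - 1) g x (fun _ => v)
        + L x * iteratedFDeriv ℝ n g x fun _ => v := by
  induction n generalizing x with
  | zero => simp
  | succ n ih =>
    have hgn : ContDiff ℝ n g := hg.of_le (by exact_mod_cast n.le_succ)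
    have hL : HasDerivAt (fun t : ℝ => L (x + t • v)) (L v) 0 := by
      simpa using ((hasDerivAt_id (0 : ℝ)).mul_const (L v)).const_add (L x)
    have hprod := hasDerivAt_iteratedFDeriv_diagonal (L.contDiff.mul hg) x v
    simp only [ih hgn] at hprod
    have hlead := hL.fun_mul (hasDerivAt_iteratedFDeriv_diagonal hg x v)
    cases n with
    | zero =>
      have := hprod.unique (by simpa using hlead)
      simpa using this
    | succ k =>
      have hlow := (hasDerivAt_iteratedFDeriv_diagonal hgn x v).const_mul (((k + 1 : ℕ) : ℝ) * L v)
      rw [hprod.unique (hlow.add hlead), Nat.add_sub_cancel (k + 1) 1, zero_smul, add_zero]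
      push_cast
      ring

section DerSum
variable {ι : Type} [Fintype ι] [DecidableEq ι] {q : ℕ}

lemma derSum_add {f g : (ι → ℝ) → ℝ} (hf : ContDiff ℝ q f) (hg : ContDiff ℝ q g) (θ : ι → ℝ) :
    DerSum q (fun θ' => f θ' + g θ') θ = DerSum q f θ + DerSum q g θ := by
  simp only [derSum_eq_iteratedFDeriv]
  rw [fun_iteratedFDeriv_add_apply hf.contDiffAt hg.contDiffAt]
  rfl

lemma derSum_sum {κ : Type*} (u : Finset κ) {f : κ → (ι → ℝ) → ℝ}
    (hf : ∀ k, ContDiff ℝ q (f k)) (θ : ι → ℝ) :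
    DerSum q (fun θ' => ∑ k ∈ u, f k θ') θ = ∑ k ∈ u, DerSum q (f k) θ := by
  simp only [derSum_eq_iteratedFDeriv]
  rw [iteratedFDeriv_fun_sum_apply fun k _ => (hf k).contDiffAt]
  simp

lemma derSum_const (hq : 0 < q) (r : ℝ) (θ : ι → ℝ) : DerSum q (fun _ => r) θ = 0 := by
  rw [derSum_eq_iteratedFDeriv, iteratedFDeriv_const_of_ne hq.ne']
  rfl

lemma derSum_coord_mul {g : (ι → ℝ) → ℝ} (hg : ContDiff ℝ q g) (r : ℝ) (ν : ι) (θ : ι → ℝ) :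
    DerSum q (fun θ' => r * θ' ν * g θ') θ
      = q * (r * DerSum (q - 1) g θ) + r * θ ν * DerSum q g θ := by
  have h := iteratedFDeriv_linear_mul_diagonal
    (r • ContinuousLinearMap.proj (R := ℝ) (φ := fun _ : ι => ℝ) ν) hg θ 1
  simp only [smul_apply, ContinuousLinearMap.proj_apply, smul_eq_mul,
    Pi.one_apply, mul_one] at h
  simp only [derSum_eq_iteratedFDeriv, h]
  ring

end DerSum

/-- Generalized Leibniz formula for the SRK stage values, as an identity
of functions of `θ`. -/
theorem srk_leibniz_formula
    (d m s q : ℕ) (hq : 0 < q) (M : Type) [Fintype M] [DecidableEq M]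
    (c : SRK m s M)
    (a : Evec d → Evec d) (b : Fin m → Evec d → Evec d)
    (ha : ContDiff ℝ q a) (hb : ∀ k, ContDiff ℝ q (b k))
    (y0 : Evec d)
    (H : (Mbar M → ℝ) → SIdx m M → Fin s → Evec d)
    (hsm : ∀ (p : SIdx m M) (i : Fin s), ContDiff ℝ q (fun θ => H θ p i))
    (hstage : ∀ θ : Mbar M → ℝ, StageEq c a b y0 θ (H θ)) :
    ∀ (θ : Mbar M → ℝ) (p : SIdx m M) (i : Fin s) (J : Fin d),
      DerSum q (fun θ' => H θ' p i J) θ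
        = (q : ℝ) * (∑ j, c.A p i j * DerSum (q-1) (fun θ' => a (H θ' .det j) J) θ)
        + (q : ℝ) * (∑ j, ∑ r, ∑ μ : M, ∑ νq : M,
            c.B νq p r μ i j * DerSum (q-1) (fun θ' => b r (H θ' (.sto r μ) j) J) θ)
        + (∑ j, c.A p i j * θ none * DerSum q (fun θ' => a (H θ' .det j) J) θ)
        + ∑ j, ∑ r, ∑ μ : M, ∑ ιi : M,
            c.B ιi p r μ i j * θ (some ιi) * DerSum q (fun θ' => b r (H θ' (.sto r μ) j) J) θ := by
  intro θ p i J
  have hcoord (ν : Mbar M) : ContDiff ℝ q fun θ' : Mbar M → ℝ => θ' ν := contDiff_apply ℝ ℝ ν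
  have hcoef (r : ℝ) (ν : Mbar M) {g : (Mbar M → ℝ) → ℝ} (hg : ContDiff ℝ q g) :
      ContDiff ℝ q fun θ' => r * θ' ν * g θ' := (contDiff_const.mul (hcoord ν)).mul hg
  have hcomp {f : Evec d → Evec d} (hf : ContDiff ℝ q f) (p' : SIdx m M) (j : Fin s) :
      ContDiff ℝ q fun θ' => f (H θ' p' j) J :=
    (contDiff_euclidean.1 (hf.comp (hsm p' j))) J
  have hA (j : Fin s) := hcoef (c.A p i j) none (hcomp ha .det j)
  have hB (j : Fin s) (r : Fin m) (μ ι : M) :=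
    hcoef (c.B ι p r μ i j) (some ι) (hcomp (hb r) (.sto r μ) j)
  have hBμ (j : Fin s) (r : Fin m) (μ : M) := ContDiff.sum fun ι (_ : ι ∈ univ) => hB j r μ ι
  have hBr (j : Fin s) (r : Fin m) := ContDiff.sum fun μ (_ : μ ∈ univ) => hBμ j r μ
  have hBj (j : Fin s) := ContDiff.sum fun r (_ : r ∈ univ) => hBr j r
  have hstageJ : (fun θ' => H θ' p i J) = fun θ' =>
      (y0 J + ∑ j, c.A p i j * θ' none * a (H θ' .det j) J)
        + ∑ j, ∑ r, ∑ μ, ∑ ι : M,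
            c.B ι p r μ i j * θ' (some ι) * b r (H θ' (.sto r μ) j) J := by
    funext θ'
    rw [hstage θ' p i]
    simp [SRK.Z, Finset.sum_mul]
  rw [hstageJ,
    derSum_add (contDiff_const.add (ContDiff.sum fun j _ => hA j)) (ContDiff.sum fun j _ => hBj j),
    derSum_add contDiff_const (ContDiff.sum fun j _ => hA j), derSum_const hq, zero_add,
    derSum_sum _ hA, derSum_sum _ hBj]
  simp only [derSum_sum _ (hBr _), derSum_sum _ (hBμ _ _), derSum_sum _ (hB _ _ _),
    derSum_coord_mul (hcomp ha _ _), derSum_coord_mul (hcomp (hb _) _ _),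
    Finset.sum_add_distrib, Finset.mul_sum]
  ring

end SRKPaper
end
end

section
/- Order of magnitude of the expected elementary weight: Suppose the random variables θ_ι(h), ι∈M, with θ_0(h)=h, satisfy the moment condition E(θ_{ν_1}^{p_1}(h)⋯θ_{ν_κ}^{p_κ}(h)) = O(h^{(p_1+…+p_κ)/2}) for all p_i∈ℕ_0 and ν_i∈M. Then for every tree t∈LTS(Δ) and every fixed choice of its variable indices j_1,…,j_{s(t)}∈{1,…,m}, the expected elementary weight satisfies E(Φ_S(t)) = O(h^{ρ(t)}), i.e. there exist constants C>0 and h_0>0 such that |E(Φ_S(t))| ≤ C·h^{ρ(t)} for all h∈(0,h_0), where ρ(t)=d(t)+s(t)/2. -/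
open scoped BigOperators
open Finset MeasureTheory ProbabilityTheory

noncomputable section

namespace SRKPaper

section OrderOfMagnitude

open MvPolynomial Asymptotics Filter Topology

/-- The order of a colour in powers of `√h`: `2` for a deterministic node, `1` for a
stochastic one. -/
def colorWeight {α : Type*} : Option α → ℕ
  | none => 2
  | some _ => 1

/-- The order of a random variable `θ_ν` in powers of `√h`. -/
def thetaWeight {M : Type} : Mbar M → ℕ := colorWeight

/-- `g` is a polynomial in the variables `θ_ν` all of whose monomials have order `n` in
powers of `√h`. -/
def IsHomogeneousIn {M : Type} (n : ℕ) (g : (Mbar M → ℝ) → ℝ) : Prop :=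
  ∃ p : MvPolynomial (Mbar M) ℝ, IsWeightedHomogeneous thetaWeight p n ∧ ∀ θ, g θ = eval θ p

namespace IsHomogeneousIn

variable {M : Type}

theorem const (r : ℝ) : IsHomogeneousIn (M := M) 0 fun _ => r :=
  ⟨C r, isWeightedHomogeneous_C _ _, fun θ => by simp⟩

theorem coord (ν : Mbar M) : IsHomogeneousIn (thetaWeight ν) fun θ => θ ν :=
  ⟨X ν, isWeightedHomogeneous_X _ _ _, fun θ => by simp⟩

theorem mul {n k : ℕ} {f g : (Mbar M → ℝ) → ℝ} (hf : IsHomogeneousIn n f)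
    (hg : IsHomogeneousIn k g) : IsHomogeneousIn (n + k) fun θ => f θ * g θ := by
  obtain ⟨p, hp, hfp⟩ := hf
  obtain ⟨q, hq, hgq⟩ := hg
  exact ⟨p * q, hp.mul hq, fun θ => by simp [hfp, hgq]⟩

theorem sum {ι : Type*} (u : Finset ι) {n : ℕ} {f : ι → (Mbar M → ℝ) → ℝ}
    (hf : ∀ i ∈ u, IsHomogeneousIn n (f i)) : IsHomogeneousIn n fun θ => ∑ i ∈ u, f i θ := by
  choose! p hp hfp using hf
  refine ⟨∑ i ∈ u, p i, ?_, fun θ => ?_⟩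
  · rw [← mem_weightedHomogeneousSubmodule]
    exact Submodule.sum_mem _ fun i hi => (mem_weightedHomogeneousSubmodule ..).2 (hp i hi)
  · rw [map_sum]
    exact Finset.sum_congr rfl fun i hi => hfp i hi θ

theorem prod {ι : Type*} (u : Finset ι) {n : ι → ℕ} {f : ι → (Mbar M → ℝ) → ℝ}
    (hf : ∀ i ∈ u, IsHomogeneousIn (n i) (f i)) :
    IsHomogeneousIn (∑ i ∈ u, n i) fun θ => ∏ i ∈ u, f i θ := by
  classical
  induction u using Finset.induction_on with
  | empty => simpa using const (M := M) 1
  | insert a u ha ih =>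
    simp only [Finset.sum_insert ha, Finset.prod_insert ha]
    exact (hf a (by simp)).mul (ih fun i hi => hf i (by simp [hi]))

theorem const_mul_coord (r : ℝ) (ν : Mbar M) :
    IsHomogeneousIn (thetaWeight ν) fun θ => r * θ ν := by
  simpa using (const r).mul (coord ν)

end IsHomogeneousIn

/-- The order of the weights `z` and `Z` with the given (second) index pair. -/
def SIdx.weight {m : ℕ} {M : Type} : SIdx m M → ℕ
  | .det => 2
  | .sto _ _ => 1

section Weights

variable {m s l : ℕ} {M : Type} [Fintype M]

theorem isHomogeneousIn_z (c : SRK m s M) (p : SIdx m M) (i : Fin s) :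
    IsHomogeneousIn p.weight fun θ => c.z θ p i := by
  cases p with
  | det => exact .const_mul_coord _ none
  | sto k ν => exact .sum _ fun ι _ => .const_mul_coord _ (some ι)

theorem isHomogeneousIn_Z (c : SRK m s M) (p q : SIdx m M) (i j : Fin s) :
    IsHomogeneousIn q.weight fun θ => c.Z θ p q i j := by
  cases q with
  | det => exact .const_mul_coord _ none
  | sto r μ => exact .sum _ fun ι _ => .const_mul_coord _ (some ι)

/-- Total order of the nodes of the subtree rooted at the nonroot node `i` (fuel-based). -/
def STree.orderAux (t : STree l m) : ℕ → Fin l → ℕ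
  | 0, _ => 0
  | fuel + 1, i => colorWeight (t.color i) + ∑ c ∈ t.child i.succ, t.orderAux fuel c

theorem STree.lt_of_mem_child_succ (t : STree l m) {i c : Fin l} (h : c ∈ t.child i.succ) :
    i < c := by
  have hf : t.father c = i.succ := by simpa [STree.child] using h
  have := t.mono c
  rw [hf, Fin.val_succ] at this
  exact Fin.lt_def.2 (by lia)

theorem STree.orderAux_congr (t : STree l m) (f g : ℕ) (i : Fin l) (hf : l ≤ i + f)
    (hg : l ≤ i + g) : t.orderAux f i = t.orderAux g i := by
  induction f generalizing g i with
  | zero => lia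
  | succ f ih =>
    cases g with
    | zero => lia
    | succ g =>
      simp only [STree.orderAux]
      congr 1
      refine Finset.sum_congr rfl fun c hc => ?_
      have := Fin.lt_def.1 (t.lt_of_mem_child_succ hc)
      exact ih g c (by lia) (by lia)

theorem STree.sum_colorWeight (t : STree l m) :
    ∑ i, colorWeight (t.color i) = 2 * t.dcount + t.scount := by
  simp only [STree.dcount, STree.scount, Finset.card_filter, Finset.mul_sum,
    ← Finset.sum_add_distrib]
  refine Finset.sum_congr rfl fun i _ => ?_
  cases t.color i <;> simp [colorWeight]

theorem STree.sum_child_zero_orderAux (t : STree l m) :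
    ∑ i ∈ t.child 0, t.orderAux (l + 1) i = 2 * t.dcount + t.scount := by
  have hrec : ∀ i, t.orderAux (l + 1) i =
      colorWeight (t.color i) + ∑ c ∈ t.child i.succ, t.orderAux (l + 1) c := fun i => by
    conv_lhs => rw [STree.orderAux]
    congr 1
    exact Finset.sum_congr rfl fun c _ => t.orderAux_congr _ _ c (by lia) (by lia)
  have hfib : ∑ v, ∑ c ∈ t.child v, t.orderAux (l + 1) c = ∑ i, t.orderAux (l + 1) i :=
    Finset.sum_fiberwise _ _ _
  have hsum : ∑ i, t.orderAux (l + 1) i = 2 * t.dcount + t.scount +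
      ∑ i : Fin l, ∑ c ∈ t.child i.succ, t.orderAux (l + 1) c := by
    rw [← t.sum_colorWeight, ← Finset.sum_add_distrib]
    exact Finset.sum_congr rfl fun i _ => hrec i
  rw [Fin.sum_univ_succ, hsum] at hfib
  exact Nat.add_right_cancel hfib

theorem isHomogeneousIn_PsiAux (c : SRK m s M) (t : STree l m) (f : ℕ) (i : Fin l)
    (p : SIdx m M) (q : Fin s) :
    IsHomogeneousIn (t.orderAux f i) fun θ => PsiAux c θ t f i p q := by
  induction f generalizing i p q with
  | zero => exact .const 1
  | succ f ih =>
    simp only [PsiAux, STree.orderAux]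
    cases t.color i with
    | none =>
      exact .sum _ fun j _ => (isHomogeneousIn_Z c p .det q j).mul
        (.prod _ fun cc _ => ih cc _ _)
    | some jj =>
      exact .sum _ fun μ _ => .sum _ fun j _ => (isHomogeneousIn_Z c p (.sto jj μ) q j).mul
        (.prod _ fun cc _ => ih cc _ _)

theorem isHomogeneousIn_phiFactor (c : SRK m s M) (t : STree l m) (i : Fin l) :
    IsHomogeneousIn (t.orderAux (l + 1) i) fun θ => phiFactor c θ t i := by
  simp only [phiFactor, STree.orderAux]
  cases t.color i with
  | none =>
    exact .sum _ fun j _ => (isHomogeneousIn_z c .det j).mul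
      (.prod _ fun cc _ => isHomogeneousIn_PsiAux c t l cc _ _)
  | some jj =>
    exact .sum _ fun μ _ => .sum _ fun j _ => (isHomogeneousIn_z c (.sto jj μ) j).mul
      (.prod _ fun cc _ => isHomogeneousIn_PsiAux c t l cc _ _)

theorem isHomogeneousIn_PhiS (c : SRK m s M) (t : STree l m) :
    IsHomogeneousIn (2 * t.dcount + t.scount) fun θ => PhiS c θ t := by
  rw [← t.sum_child_zero_orderAux]
  exact .prod _ fun i _ => isHomogeneousIn_phiFactor c t i

end Weights

theorem isBigO_nhdsGT_zero_iff {f g : ℝ → ℝ} (hg : ∀ h, 0 ≤ g h) :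
    f =O[𝓝[>] 0] g ↔
      ∃ C > (0:ℝ), ∃ h0 > (0:ℝ), ∀ h : ℝ, 0 < h → h < h0 → |f h| ≤ C * g h := by
  rw [isBigO_iff']
  refine exists_congr fun C => and_congr_right fun _ => ?_
  rw [(nhdsGT_basis (0:ℝ)).eventually_iff]
  simp only [Set.mem_Ioo, and_imp, Real.norm_eq_abs, abs_of_nonneg (hg _), gt_iff_lt]

theorem IsHomogeneousIn.isBigO_integral {M Ω : Type} [Fintype M] [MeasurableSpace Ω]
    {P : Measure Ω} {θf : ℝ → M → Ω → ℝ}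
    (hintg : ∀ (h : ℝ) (pe : M → ℕ), Integrable (fun ω => ∏ ι : M, (θf h ι ω)^(pe ι)) P)
    (hmom : ∀ pe : M → ℕ, (fun h => ∫ ω, ∏ ι : M, (θf h ι ω)^(pe ι) ∂P)
      =O[𝓝[>] 0] fun h => (Real.sqrt h)^(∑ ι : M, pe ι))
    {n : ℕ} {g : (Mbar M → ℝ) → ℝ} (hg : IsHomogeneousIn n g) :
    (fun h => ∫ ω, g (fun ν => Option.elim ν h (fun ι => θf h ι ω)) ∂P)
      =O[𝓝[>] 0] fun h => (Real.sqrt h)^n := by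
  obtain ⟨p, hp, hgp⟩ := hg
  have hexp : ∀ h, ∫ ω, g (fun ν => Option.elim ν h (fun ι => θf h ι ω)) ∂P =
      ∑ e ∈ p.support, coeff e p *
        (h ^ e none * ∫ ω, ∏ ι : M, (θf h ι ω)^(e (some ι)) ∂P) := fun h => by
    simp only [hgp, eval_eq', Fintype.prod_option, Option.elim_none, Option.elim_some]
    rw [integral_finsetSum _ fun e _ => ((hintg h _).const_mul _).const_mul _]
    simp only [integral_const_mul]
  simp only [hexp]
  refine IsBigO.fun_sum fun e he => IsBigO.const_mul_left ?_ _
  have hw := hp (mem_support_iff.1 he)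
  rw [Finsupp.weight_apply, Finsupp.sum_fintype _ _ (by simp), Fintype.sum_option] at hw
  simp only [thetaWeight, colorWeight, smul_eq_mul, mul_one] at hw
  subst hw
  simp only [pow_add]
  refine IsBigO.mul (EventuallyEq.isBigO ?_) (hmom _)
  filter_upwards [self_mem_nhdsWithin] with h hh
  rw [mul_comm, pow_mul, Real.sq_sqrt (le_of_lt hh)]

end OrderOfMagnitude

/-- Order of magnitude of the expected elementary weight:
under the moment condition `E(∏ θ_ι^{p_ι}) = O(h^{(∑p_ι)/2})`, for every tree of
`LTS(Δ)` (with fixed variable indices) one has `E(Φ_S(t)) = O(h^{ρ(t)})`,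
`ρ(t) = d(t) + s(t)/2`. -/
theorem expected_elementary_weight_order
    (d m s : ℕ) (M : Type) [Fintype M] [DecidableEq M]
    (c : SRK m s M)
    (Ω : Type) [MeasurableSpace Ω] (P : Measure Ω) [IsProbabilityMeasure P]
    (θf : ℝ → M → Ω → ℝ) (hmeas : ∀ h ι, Measurable (θf h ι))
    (hintg : ∀ (h : ℝ) (pe : M → ℕ), Integrable (fun ω => ∏ ι : M, (θf h ι ω)^(pe ι)) P)
    (hmom : ∀ pe : M → ℕ, ∃ C > (0:ℝ), ∃ h0 > (0:ℝ), ∀ h : ℝ, 0 < h → h < h0 →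
      |∫ ω, ∏ ι : M, (θf h ι ω)^(pe ι) ∂P| ≤ C * (Real.sqrt h)^(∑ ι : M, pe ι))
    (l : ℕ) (t : STree l m) :
    ∃ C > (0:ℝ), ∃ h0 > (0:ℝ), ∀ h : ℝ, 0 < h → h < h0 →
      |∫ ω, PhiS c (fun ν => Option.elim ν h (fun ι => θf h ι ω)) t ∂P|
        ≤ C * (Real.sqrt h)^(2 * t.dcount + t.scount) := by
  rw [← isBigO_nhdsGT_zero_iff fun h => by positivity]
  exact (isHomogeneousIn_PhiS c t).isBigO_integral hintg fun pe =>
    (isBigO_nhdsGT_zero_iff fun h => by positivity).2 (hmom pe)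

end SRKPaper
end
end

section
/- A priori bound for the SRK stage values: Suppose b^0=a, b^1,…,b^m:ℝ^d→ℝ^d satisfy the linear growth condition ‖b^k(x)‖ ≤ C_1(1+‖x‖) for all x. Let C_2 ≥ 1 bound the operator norms of all coefficient matrices B^{(ι)(k,ν),(r,μ)} and A^{(k,ν),(0,0)} acting on (ℝ^d)^s equipped with the norm ‖H‖=max_{1≤i≤s}‖H_i‖ (and of the embedding x↦(x,…,x)), and put C_3=(m+1)·|M̄|^2·C_1·C_2. Let Y_n∈ℝ^d and let real numbers θ_ι, ι∈M̄ (with θ_0 the step size), satisfy max_{ι∈M̄}|θ_ι| ≤ 1/(2C_3). Then any family of stage values (H_i^{(k,ν)})_{1≤i≤s, 0≤k≤m, ν∈M̄} in ℝ^d satisfying the stage equations with starting value Y_n obeys max_{(k,ν)} max_{1≤i≤s} ‖H_i^{(k,ν)}‖ ≤ 2C_2‖Y_n‖ + 2C_3·max_{ι∈M̄}|θ_ι| ≤ C_4(1+‖Y_n‖), where C_4 = max{2C_2, 1}. -/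
open scoped BigOperators
open Finset MeasureTheory ProbabilityTheory

noncomputable section

namespace SRKPaper

instance [Finite M] : Finite (SIdx m M) :=
  Finite.of_injective (β := Option (Fin m × M))
    (fun | .det => none | .sto k ν => some (k, ν))
    (by rintro (_ | ⟨k, ν⟩) (_ | ⟨k', ν'⟩) h <;> simp_all)

lemma norm_sum_smul_le_of_le {ι E : Type*} [Fintype ι] [SeminormedAddCommGroup E]
    [NormedSpace ℝ E] {w : ι → ℝ} {v : ι → E} {W K : ℝ} (hK : 0 ≤ K)
    (hw : ∑ j, |w j| ≤ W) (hv : ∀ j, ‖v j‖ ≤ K) : ‖∑ j, w j • v j‖ ≤ W * K :=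
  calc ‖∑ j, w j • v j‖ ≤ ∑ j, |w j| * K := norm_sum_le_of_le _ fun j _ => by
        rw [norm_smul, Real.norm_eq_abs]
        exact mul_le_mul_of_nonneg_left (hv j) (abs_nonneg _)
    _ ≤ W * K := by
        rw [← Finset.sum_mul]
        exact mul_le_mul_of_nonneg_right hw hK

section StageBound
variable [Fintype M] {c : SRK m s M} {θ : Mbar M → ℝ} {C T : ℝ}

lemma SRK.sum_abs_Z_det_le (hC : 0 ≤ C) {p : SIdx m M} {i : Fin s}
    (hA : ∑ j, |c.A p i j| ≤ C) (hT : ∀ ι, |θ ι| ≤ T) :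
    ∑ j, |c.Z θ p .det i j| ≤ C * T := by
  simp only [SRK.Z, abs_mul]
  rw [← Finset.sum_mul]
  exact mul_le_mul hA (hT _) (abs_nonneg _) hC

lemma SRK.sum_abs_Z_sto_le (hC : 0 ≤ C) {p : SIdx m M} {r : Fin m} {μ : M} {i : Fin s}
    (hB : ∀ ι, ∑ j, |c.B ι p r μ i j| ≤ C) (hT : ∀ ι, |θ ι| ≤ T) :
    ∑ j, |c.Z θ p (.sto r μ) i j| ≤ Fintype.card M * (C * T) :=
  calc ∑ j, |c.Z θ p (.sto r μ) i j|
      ≤ ∑ j, ∑ ι, |c.B ι p r μ i j| * |θ (some ι)| := Finset.sum_le_sum fun j _ => by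
        simp only [SRK.Z, ← abs_mul]
        exact Finset.abs_sum_le_sum_abs _ _
    _ = ∑ ι, (∑ j, |c.B ι p r μ i j|) * |θ (some ι)| := by
        rw [Finset.sum_comm]
        simp only [Finset.sum_mul]
    _ ≤ ∑ _ι : M, C * T := Finset.sum_le_sum fun ι _ =>
        mul_le_mul (hB ι) (hT _) (abs_nonneg _) hC
    _ = Fintype.card M * (C * T) := by simp

/-- One application of the stage map to stage values on which `a` and `b` are bounded by `K`. -/
lemma StageEq.norm_le {a : Evec d → Evec d} {b : Fin m → Evec d → Evec d} {y : Evec d}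
    {H : SIdx m M → Fin s → Evec d} (hstage : StageEq c a b y θ H) (hC : 0 ≤ C)
    (hA : ∀ (p : SIdx m M) (i : Fin s), ∑ j, |c.A p i j| ≤ C)
    (hB : ∀ (ι : M) (p : SIdx m M) (r : Fin m) (μ : M) (i : Fin s), ∑ j, |c.B ι p r μ i j| ≤ C)
    (hT : ∀ ι, |θ ι| ≤ T) {K : ℝ} (hK : 0 ≤ K) (ha : ∀ p j, ‖a (H p j)‖ ≤ K)
    (hb : ∀ r p j, ‖b r (H p j)‖ ≤ K) (p : SIdx m M) (i : Fin s) :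
    ‖H p i‖ ≤ ‖y‖ + (1 + m * (Fintype.card M : ℝ) ^ 2) * (C * T * K) := by
  have hdet : ‖∑ j, c.Z θ p .det i j • a (H .det j)‖ ≤ C * T * K :=
    norm_sum_smul_le_of_le hK (SRK.sum_abs_Z_det_le hC (hA p i) hT) (ha _)
  have hsto : ‖∑ j, ∑ r, ∑ μ, c.Z θ p (.sto r μ) i j • b r (H (.sto r μ) j)‖
      ≤ m * (Fintype.card M : ℝ) ^ 2 * (C * T * K) := by
    simp only [Finset.sum_comm (s := (Finset.univ : Finset (Fin s)))]
    calc _ ≤ ∑ _r : Fin m, ∑ _μ : M, Fintype.card M * (C * T) * K :=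
          norm_sum_le_of_le _ fun r _ => norm_sum_le_of_le _ fun μ _ =>
            norm_sum_smul_le_of_le hK
              (SRK.sum_abs_Z_sto_le hC (fun ι => hB ι p r μ i) hT) (hb r _)
      _ = _ := by
          simp only [Finset.sum_const, Finset.card_univ, Fintype.card_fin, nsmul_eq_mul]
          ring
  rw [hstage p i]
  calc _ ≤ ‖y‖ + C * T * K + m * (Fintype.card M : ℝ) ^ 2 * (C * T * K) :=
        norm_add₃_le.trans (add_le_add (add_le_add le_rfl hdet) hsto)
    _ = _ := by ring

end StageBound

/-- A priori bound for the SRK stage values. -/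
theorem srk_stage_values_bound
    (d m s : ℕ) (M : Type) [Fintype M] [DecidableEq M]
    (c : SRK m s M)
    (a : Evec d → Evec d) (b : Fin m → Evec d → Evec d)
    (C1 C2 C3 : ℝ) (hC1 : 0 < C1)
    (hgrowa : ∀ x, ‖a x‖ ≤ C1 * (1 + ‖x‖)) (hgrowb : ∀ k x, ‖b k x‖ ≤ C1 * (1 + ‖x‖))
    (hC2 : 1 ≤ C2)
    (hA : ∀ (p : SIdx m M) (i : Fin s), ∑ j, |c.A p i j| ≤ C2)
    (hB : ∀ (ι : M) (p : SIdx m M) (r : Fin m) (μ : M) (i : Fin s), ∑ j, |c.B ι p r μ i j| ≤ C2)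
    (hC3 : C3 = ((m : ℝ) + 1) * ((Fintype.card M : ℝ) + 1)^2 * C1 * C2)
    (y : Evec d) (θ : Mbar M → ℝ)
    (hθ : ∀ ι : Mbar M, |θ ι| ≤ 1/(2*C3))
    (H : SIdx m M → Fin s → Evec d)
    (hstage : StageEq c a b y θ H) :
    ∀ (p : SIdx m M) (i : Fin s),
      ‖H p i‖ ≤ 2*C2*‖y‖
          + 2*C3 * (Finset.univ.sup' Finset.univ_nonempty fun ι : Mbar M => |θ ι|)
      ∧ 2*C2*‖y‖ + 2*C3 * (Finset.univ.sup' Finset.univ_nonempty fun ι : Mbar M => |θ ι|)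
          ≤ max (2*C2) 1 * (1 + ‖y‖) := by
  intro p i
  set T := Finset.univ.sup' Finset.univ_nonempty fun ι : Mbar M => |θ ι|
  have hθT : ∀ ι, |θ ι| ≤ T := fun ι =>
    Finset.le_sup' (fun ι : Mbar M => |θ ι|) (Finset.mem_univ ι)
  have hT0 : 0 ≤ T := (abs_nonneg _).trans (hθT none)
  have hC3pos : 0 < C3 := by rw [hC3]; positivity
  have hT : C3 * T ≤ 1 / 2 := by
    have h : T ≤ 1 / (2 * C3) := Finset.sup'_le _ _ fun ι _ => hθ ι
    rw [le_div_iff₀ (by positivity)] at h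
    linarith
  have hy : 0 ≤ ‖y‖ := norm_nonneg y
  refine ⟨?_, ?_⟩
  · have : Nonempty (SIdx m M × Fin s) := ⟨(p, i)⟩
    obtain ⟨⟨q, k⟩, hmax⟩ := Finite.exists_max fun x : SIdx m M × Fin s => ‖H x.1 x.2‖
    have hmax' : ∀ p j, ‖H p j‖ ≤ ‖H q k‖ := fun p j => hmax (p, j)
    have hX : 0 ≤ ‖H q k‖ := norm_nonneg _
    have hgrow : ∀ p j, C1 * (1 + ‖H p j‖) ≤ C1 * (1 + ‖H q k‖) := fun p j => by
      gcongr
      exact hmax' p j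
    have hstep := hstage.norm_le (by positivity) hA hB hθT (by positivity)
      (fun p j => (hgrowa _).trans (hgrow p j)) (fun r p j => (hgrowb r _).trans (hgrow p j)) q k
    have hcount : 1 + m * (Fintype.card M : ℝ) ^ 2
        ≤ ((m : ℝ) + 1) * ((Fintype.card M : ℝ) + 1) ^ 2 := by
      have hm : (0 : ℝ) ≤ m := by positivity
      have hM : (0 : ℝ) ≤ Fintype.card M := by positivity
      nlinarith [mul_nonneg hm hM, sq_nonneg (Fintype.card M : ℝ)]
    have hbound : ‖H q k‖ ≤ ‖y‖ + C3 * T * (1 + ‖H q k‖) :=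
      calc _ ≤ ‖y‖ + ((m : ℝ) + 1) * ((Fintype.card M : ℝ) + 1) ^ 2
              * (C2 * T * (C1 * (1 + ‖H q k‖))) := by
            refine hstep.trans ?_
            gcongr
        _ = _ := by rw [hC3]; ring
    have := mul_le_mul_of_nonneg_right hT hX
    have := mul_le_mul_of_nonneg_right hC2 hy
    linarith [hmax' p i]
  · have := mul_le_mul_of_nonneg_right (le_max_left (2 * C2) 1) hy
    linarith [le_max_right (2 * C2) 1]

end SRKPaper
end
end
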